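/- arXiv:2307.00970 — 5 statements merged into one kernel-verified Lean document; each statement's English description precedes it below -/
import Mathlib

section
/- For all real numbers a, b, c with a² + b² + c² = 1, the absolute value of D(a,b,c) is at most √3/(2¹⁹·3¹⁴). (This is the global maximum of the absolute value of the 3×3×3 hyperdeterminant restricted to real semi-simple 3-qutrit states.) -/
/-- Restriction of the 3×3×3 hyperdeterminant to normalized semi-simple states
`a|v₁⟩ + b|v₂⟩ + c|v₃⟩`. -/
noncomputable def D (a b c : ℝ) : ℝ :=
  -(4 / 3 ^ 18) * a ^ 3 * b ^ 3 * c ^ 3 * (a + b + c) ^ 3 *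
    (a ^ 2 + 2 * a * b - a * c + b ^ 2 - b * c + c ^ 2) ^ 3 *
    (a ^ 2 - a * b + 2 * a * c + b ^ 2 - b * c + c ^ 2) ^ 3 *
    (a ^ 2 - a * b - a * c + b ^ 2 + 2 * b * c + c ^ 2) ^ 3 *
    (a ^ 2 - a * b - a * c + b ^ 2 - b * c + c ^ 2) ^ 3

lemma cof_pos (y : ℝ) : 0 ≤ 27*y^20 + 108*y^19 + 1080*y^18 + 4104*y^17 + 6188*y^16 + 15680*y^15
    + 73088*y^14 + 29824*y^13 + 182944*y^12 + 84352*y^11 + 392448*y^10 - 13056*y^9 + 137856*y^8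
    - 238592*y^7 + 317440*y^6 + 219136*y^5 + 396032*y^4 - 1024*y^3 + 14336*y^2 - 55296*y
    + 27648 := by
  rcases le_total 0 y with h | h
  · have h1 : 0 ≤ 27*y^20 + 108*y^19 + 1080*y^18 + 4104*y^17 + 6188*y^16 + 15680*y^15
      + 73088*y^14 + 29824*y^13 + 182944*y^12 + 84352*y^11 + 219136*y^5 := by positivity
    have h2 : 0 ≤ y^8 * (392448*y^2 - 13056*y + 1000) :=
      mul_nonneg (by positivity) (by nlinarith [sq_nonneg (y - 1/60)])
    have h3 : 0 ≤ y^6 * (136856*y^2 - 238592*y + 317440) :=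
      mul_nonneg (by positivity) (by nlinarith [sq_nonneg (y - 1)])
    have h4 : 0 ≤ 396032*y^4 - 1024*y^3 + 14336*y^2 - 55296*y + 27648 := by
      nlinarith [sq_nonneg (y^2 - 0.2), sq_nonneg (y - 0.16), sq_nonneg (y^2 - y), sq_nonneg y]
    nlinarith
  · obtain ⟨x, rfl⟩ : ∃ x, y = -x := ⟨-y, by ring⟩
    have hx : 0 ≤ x := by linarith
    have h1 : 0 ≤ x^18 * (27*x^2 - 108*x + 108) :=
      mul_nonneg (by positivity) (by nlinarith [sq_nonneg (x - 2)])
    have h2 : 0 ≤ x^16 * (972*x^2 - 4104*x + 4400) :=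
      mul_nonneg (by positivity) (by nlinarith [sq_nonneg (x - 2.1)])
    have h3 : 0 ≤ x^14 * (1788*x^2 - 15680*x + 35000) :=
      mul_nonneg (by positivity) (by nlinarith [sq_nonneg (x - 4.385)])
    have h4 : 0 ≤ x^12 * (38088*x^2 - 29824*x + 6000) :=
      mul_nonneg (by positivity) (by nlinarith [sq_nonneg (x - 0.39)])
    have h5 : 0 ≤ x^10 * (176944*x^2 - 84352*x + 11000) :=
      mul_nonneg (by positivity) (by nlinarith [sq_nonneg (x - 0.24)])
    have h6 : 0 ≤ x^4 * (317440*x^2 - 219136*x + 396032) :=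
      mul_nonneg (by positivity) (by nlinarith [sq_nonneg (x - 0.4)])
    have h7 : 0 ≤ 381448*x^10 + 13056*x^9 + 137856*x^8 + 238592*x^7 + 1024*x^3 + 14336*x^2
      + 55296*x + 27648 := by positivity
    nlinarith

lemma uni (y : ℝ) : 2^14 * (y*(8+y^3)*(1-y^3)^2)^2 ≤ 27*(2+y^2)^12 := by
  have := mul_nonneg (sq_nonneg (y^2-2*y-2)) (cof_pos y)
  nlinarith

lemma hom (A C : ℝ) (h : 2*A^2+C^2 = 1) :
    2^14 * (A^2*C*(8*A^3+C^3)*(A^3-C^3)^2)^2 ≤ 27 := by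
  by_cases hA : A = 0
  · subst hA; norm_num
  · have h1 := uni (C/A)
    have h2 := mul_le_mul_of_nonneg_left h1 (show 0 ≤ A^24 by positivity)
    have e1 : A^24 * (2^14 * ((C/A)*(8+(C/A)^3)*(1-(C/A)^3)^2)^2)
        = 2^14 * (A^2*C*(8*A^3+C^3)*(A^3-C^3)^2)^2 := by
      field_simp
    have e2 : A^24 * (27*(2+(C/A)^2)^12) = 27*(2*A^2+C^2)^12 := by
      field_simp
    rw [e1, e2, h] at h2
    linarith

lemma endp (s r : ℝ) (h : s^2+2*r^2 = 3) :
    2^14 * (s*r^2*(((s^3+2*r^3)/3)^3 - (r^2*s)^3)/27)^2 ≤ 27 := by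
  have := hom ((s-r)/3) ((s+2*r)/3) (by linear_combination h/3)
  convert this using 3
  ring

lemma sq_between (k d x u v M : ℝ) (h1 : u ≤ x) (h2 : x ≤ v)
    (hu : (k*(u-d))^2 ≤ M) (hv : (k*(v-d))^2 ≤ M) : (k*(x-d))^2 ≤ M := by
  have hc : 0 ≤ (x-u)*(v-x) := mul_nonneg (by linarith) (by linarith)
  rcases le_total d x with hd | hd
  · have : (x-d)^2 ≤ (v-d)^2 := by nlinarith
    nlinarith [mul_le_mul_of_nonneg_left this (sq_nonneg k)]
  · have : (x-d)^2 ≤ (u-d)^2 := by nlinarith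
    nlinarith [mul_le_mul_of_nonneg_left this (sq_nonneg k)]

lemma P_sq (a b c : ℝ) (h : a ^ 2 + b ^ 2 + c ^ 2 = 1) :
    2^14 * (a*b*c*(a+b+c)*(a ^ 2 + 2 * a * b - a * c + b ^ 2 - b * c + c ^ 2)*
    (a ^ 2 - a * b + 2 * a * c + b ^ 2 - b * c + c ^ 2) *
    (a ^ 2 - a * b - a * c + b ^ 2 + 2 * b * c + c ^ 2) *
    (a ^ 2 - a * b - a * c + b ^ 2 - b * c + c ^ 2))^2 ≤ 27 := by
  obtain ⟨m, hm⟩ : ∃ m, m = a ^ 2 - a * b - a * c + b ^ 2 - b * c + c ^ 2 := ⟨_, rfl⟩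
  obtain ⟨s, hs⟩ : ∃ s, s = a + b + c := ⟨_, rfl⟩
  obtain ⟨w, hw⟩ : ∃ w, w = a^3+b^3+c^3+6*a*b*c := ⟨_, rfl⟩
  have hm0 : 0 ≤ m := by
    rw [hm]; nlinarith [sq_nonneg (a-b), sq_nonneg (b-c), sq_nonneg (a-c)]
  have hsm : s^2 + 2*m = 3 := by rw [hs, hm]; linear_combination 3*h
  have hP : a*b*c*(a+b+c)*(a ^ 2 + 2 * a * b - a * c + b ^ 2 - b * c + c ^ 2)*
    (a ^ 2 - a * b + 2 * a * c + b ^ 2 - b * c + c ^ 2) *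
    (a ^ 2 - a * b - a * c + b ^ 2 + 2 * b * c + c ^ 2) *
    (a ^ 2 - a * b - a * c + b ^ 2 - b * c + c ^ 2) = s*m/27*(w^3-(m*s)^3) := by
    rw [hs, hm, hw]; ring
  rw [hP]
  have hdisc : (w - s^3/3)^2 ≤ 4/9*m^3 := by
    have : 4/9*m^3 - (w-s^3/3)^2 = 3*((a-b)*(b-c)*(c-a))^2 := by
      rw [hs, hm, hw]; ring
    nlinarith [sq_nonneg ((a-b)*(b-c)*(c-a))]
  obtain ⟨r, hr⟩ : ∃ r, r = Real.sqrt m := ⟨_, rfl⟩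
  have hr0 : 0 ≤ r := hr ▸ Real.sqrt_nonneg m
  have hrm : m = r^2 := by rw [hr, Real.sq_sqrt hm0]
  subst hrm
  have habs := abs_le_of_sq_le_sq' (show (w - s^3/3)^2 ≤ (2/3*r^3)^2 by
    calc _ ≤ _ := hdisc
      _ = _ := by ring) (by positivity)
  have e1 := endp s r hsm
  have e2 := endp s (-r) (by linarith [neg_sq r])
  have h1 : ((s^3+2*(-r)^3)/3)^3 ≤ w^3 :=
    (Odd.strictMono_pow (by decide)).monotone (by linarith [habs.1, show (-r)^3 = -r^3 by ring])
  have h2 : w^3 ≤ ((s^3+2*r^3)/3)^3 :=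
    (Odd.strictMono_pow (by decide)).monotone (by linarith [habs.2])
  have := sq_between (s*r^2/27) ((r^2*s)^3) (w^3) _ _ (27/2^14) h1 h2
    (by
      rw [le_div_iff₀ (by norm_num)]
      calc _ = _ := by ring
        _ ≤ _ := e2)
    (by
      rw [le_div_iff₀ (by norm_num)]
      calc _ = _ := by ring
        _ ≤ _ := e1)
  linarith

/-- The global maximum of `|Δ₃₃₃|` on real semi-simple 3-qutrit states is
`√3 / (2¹⁹ · 3¹⁴)`. -/
theorem abs_D_le (a b c : ℝ) (h : a ^ 2 + b ^ 2 + c ^ 2 = 1) :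
    |D a b c| ≤ Real.sqrt 3 / (2 ^ 19 * 3 ^ 14) := by
  have hP := P_sq a b c h
  obtain ⟨P, hPd⟩ : ∃ P, P = a*b*c*(a+b+c)*(a ^ 2 + 2 * a * b - a * c + b ^ 2 - b * c + c ^ 2)*
    (a ^ 2 - a * b + 2 * a * c + b ^ 2 - b * c + c ^ 2) *
    (a ^ 2 - a * b - a * c + b ^ 2 + 2 * b * c + c ^ 2) *
    (a ^ 2 - a * b - a * c + b ^ 2 - b * c + c ^ 2) := ⟨_, rfl⟩
  rw [← hPd] at hP
  have hD : D a b c = -(4/3^18) * P^3 := by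
    rw [hPd]; unfold D; simp only [mul_pow]; simp only [mul_assoc]
  rw [hD]
  apply abs_le_of_sq_le_sq _ (by positivity)
  rw [div_pow, Real.sq_sqrt (by norm_num)]
  have h3 : (P^2)^3 ≤ (27/2^14)^3 :=
    pow_le_pow_left₀ (sq_nonneg P) (by linarith) 3
  calc (-(4/3^18) * P^3)^2 = 16/3^36 * (P^2)^3 := by ring
    _ ≤ 16/3^36 * (27/2^14)^3 := by gcongr
    _ = _ := by norm_num
end

section
/- For real numbers a, b, c with a² + b² + c² = 1, one has |D(a,b,c)| = √3/(2¹⁹·3¹⁴) if and only if (a,b,c) is a permutation of a point of the form (r·s, s, s) where r = 1 + √3 or r = 1 − √3, and s = 1/√(r² + 2) or s = −1/√(r² + 2). In particular there are exactly 12 such maximizing points on the unit sphere. -/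
/-- The product of the factors of `D`, without the cubes. -/
noncomputable def PP (a b c : ℝ) : ℝ :=
  a * b * c * (a + b + c) *
    (a ^ 2 + 2 * a * b - a * c + b ^ 2 - b * c + c ^ 2) *
    (a ^ 2 - a * b + 2 * a * c + b ^ 2 - b * c + c ^ 2) *
    (a ^ 2 - a * b - a * c + b ^ 2 + 2 * b * c + c ^ 2) *
    (a ^ 2 - a * b - a * c + b ^ 2 - b * c + c ^ 2)

lemma sqrt3_sq : Real.sqrt 3 ^ 2 = 3 := Real.sq_sqrt (by norm_num)

lemma sqrt3_lo : 1.73 < Real.sqrt 3 := by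
  apply Real.lt_sqrt_of_sq_lt; norm_num

lemma sqrt3_hi : Real.sqrt 3 < 1.74 := by
  rw [Real.sqrt_lt' (by norm_num)]; norm_num

lemma absD_iff (a b c : ℝ) : |D a b c| = Real.sqrt 3 / (2 ^ 19 * 3 ^ 14) ↔
    |PP a b c| = 3 * Real.sqrt 3 / 128 := by
  have h1 : D a b c = -(4 / 3 ^ 18) * (PP a b c) ^ 3 := by unfold D PP; ring
  have h2 : |D a b c| = 4 / 3 ^ 18 * |PP a b c| ^ 3 := by
    rw [h1, abs_mul, abs_pow, abs_neg, abs_of_pos (by norm_num : (0:ℝ) < 4 / 3 ^ 18)]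
  have h3 : Real.sqrt 3 / (2 ^ 19 * 3 ^ 14) = 4 / 3 ^ 18 * (3 * Real.sqrt 3 / 128) ^ 3 := by
    have : Real.sqrt 3 ^ 3 = 3 * Real.sqrt 3 := by rw [pow_succ, sqrt3_sq]
    rw [div_pow, mul_pow, this]; ring
  rw [h2, h3]
  constructor
  · intro h
    have h4 : |PP a b c| ^ 3 = (3 * Real.sqrt 3 / 128) ^ 3 :=
      mul_left_cancel₀ (by norm_num) h
    exact (pow_left_inj₀ (abs_nonneg _) (by positivity) (by norm_num)).1 h4
  · intro h; rw [h]

lemma PP_swap12 (a b c : ℝ) : PP a b c = PP b a c := by unfold PP; ring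
lemma PP_swap23 (a b c : ℝ) : PP a b c = PP a c b := by unfold PP; ring

/-- The form of `PP` on the plane of two equal coordinates. -/
lemma PP_two (x y : ℝ) (h : x ^ 2 + 2 * y ^ 2 = 1) :
    PP x y y = ((x ^ 2 + 4 * x * y - 2 * y ^ 2) ^ 2 - 1) * (9 - (x ^ 2 + 4 * x * y - 2 * y ^ 2) ^ 2)
      * ((x ^ 2 + 4 * x * y - 2 * y ^ 2) ^ 2 + 2 * (x ^ 2 + 4 * x * y - 2 * y ^ 2) - 3) / 1024 := by
  have key : ∀ N : ℝ, N = x ^ 2 + 2 * y ^ 2 → PP x y y =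
      ((x ^ 2 + 4 * x * y - 2 * y ^ 2) ^ 2 - N ^ 2) * (9 * N ^ 2 - (x ^ 2 + 4 * x * y - 2 * y ^ 2) ^ 2)
      * ((x ^ 2 + 4 * x * y - 2 * y ^ 2) ^ 2 + 2 * (x ^ 2 + 4 * x * y - 2 * y ^ 2) * N - 3 * N ^ 2)
        / 1024 := by
    rintro N rfl; unfold PP; ring
  rw [key 1 h.symm]; ring

lemma quad_rel (x y : ℝ) (h : x ^ 2 + 2 * y ^ 2 = 1) :
    (x ^ 2 + 4 * x * y - 2 * y ^ 2) ^ 2 = 3 - 2 * (x ^ 2 - 2 * x * y - 2 * y ^ 2) ^ 2 := by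
  linear_combination 3 * (x ^ 2 + 2 * y ^ 2 + 1) * h

/-- The one-variable bound, for nonnegative argument. -/
lemma bound_pos (x : ℝ) (hx : 0 ≤ x) (h : x ^ 2 < 3) :
    |x ^ 2 - 1| * (9 - x ^ 2) * (3 - x ^ 2 + 2 * x) < 24 * Real.sqrt 3 := by
  have hl := sqrt3_lo
  have hh := sqrt3_hi
  have hs := sqrt3_sq
  have hx3 : x < Real.sqrt 3 := by nlinarith
  rcases le_total (x ^ 2) 1 with h1 | h1
  · rw [abs_of_nonpos (by linarith)]
    have hx1 : x ≤ 1 := by nlinarith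
    have e : -(x ^ 2 - 1) * (9 - x ^ 2) * (3 - x ^ 2 + 2 * x)
        = ((1 - x) * (1 + x) ^ 2) * ((9 - x ^ 2) * (3 - x)) := by ring
    rw [e]
    have a1 : (1 - x) * (1 + x) ^ 2 ≤ 32 / 27 := by nlinarith [mul_nonneg (by linarith : (0:ℝ) ≤ x + 5/3) (sq_nonneg (x - 1/3))]
    have a2 : (9 - x ^ 2) * (3 - x) ≤ 9 * 3 :=
      mul_le_mul (by nlinarith) (by linarith) (by linarith) (by norm_num)
    have a3 : ((1 - x) * (1 + x) ^ 2) * ((9 - x ^ 2) * (3 - x)) ≤ 32 / 27 * (9 * 3) :=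
      mul_le_mul a1 a2 (mul_nonneg (by linarith) (by linarith)) (by norm_num)
    linarith
  · rw [abs_of_nonneg (by linarith)]
    set d := 3 - x ^ 2 with hd
    have hd0 : 0 < d := by linarith
    have hd2 : d ≤ 2 := by linarith
    have b1 : 2 * x ≤ 2 * Real.sqrt 3 - d * (Real.sqrt 3 / 3) := by
      have : 2 * Real.sqrt 3 * x ≤ 6 - d := by nlinarith [sq_nonneg (x - Real.sqrt 3)]
      nlinarith
    have e : (x ^ 2 - 1) * (9 - x ^ 2) = 12 - 4 * d - d ^ 2 := by rw [hd]; ring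
    rw [e]
    have b2 : 12 - 4 * d - d ^ 2 ≤ 12 - 4 * d := by nlinarith
    have b3 : (12 - 4 * d - d ^ 2) * (d + 2 * x)
        ≤ (12 - 4 * d) * (d + (2 * Real.sqrt 3 - d * (Real.sqrt 3 / 3))) :=
      mul_le_mul b2 (by linarith) (by linarith) (by linarith)
    have b4 : (12 - 4 * d) * (d + (2 * Real.sqrt 3 - d * (Real.sqrt 3 / 3)))
        = 24 * Real.sqrt 3 - d * (12 * Real.sqrt 3 - 12 + 4 * d * (1 - Real.sqrt 3 / 3)) := by ring
    have b5 : 0 < d * (12 * Real.sqrt 3 - 12 + 4 * d * (1 - Real.sqrt 3 / 3)) := by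
      apply mul_pos hd0
      have : 0 ≤ 4 * d * (1 - Real.sqrt 3 / 3) := mul_nonneg (by linarith) (by linarith)
      linarith
    linarith

lemma bound_all (A : ℝ) (h : A ^ 2 < 3) :
    |(A ^ 2 - 1) * (9 - A ^ 2) * (A ^ 2 + 2 * A - 3) / 1024| < 3 * Real.sqrt 3 / 128 := by
  have hb := bound_pos |A| (abs_nonneg _) (by rwa [sq_abs])
  rw [sq_abs] at hb
  rw [abs_div, abs_mul, abs_mul, abs_of_pos (by linarith : (0:ℝ) < 9 - A ^ 2),
    abs_of_pos (by norm_num : (0:ℝ) < 1024)]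
  have h1 : |A ^ 2 + 2 * A - 3| ≤ 3 - A ^ 2 + 2 * |A| := by
    rw [abs_le]; constructor <;> linarith [le_abs_self A, neg_abs_le A]
  have h2 : |A ^ 2 - 1| * (9 - A ^ 2) * |A ^ 2 + 2 * A - 3|
      ≤ |A ^ 2 - 1| * (9 - A ^ 2) * (3 - A ^ 2 + 2 * |A|) :=
    mul_le_mul_of_nonneg_left h1 (mul_nonneg (abs_nonneg _) (by linarith))
  linarith

lemma PP_two_eq (x y : ℝ) (h : x ^ 2 + 2 * y ^ 2 = 1) (hB : x ^ 2 - 2 * x * y - 2 * y ^ 2 = 0) :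
    |PP x y y| = 3 * Real.sqrt 3 / 128 := by
  have hA := quad_rel x y h
  rw [PP_two x y h]
  rw [hB] at hA
  generalize x ^ 2 + 4 * x * y - 2 * y ^ 2 = A at *
  have hA3 : A ^ 2 = 3 := by linarith
  have : |A| = Real.sqrt 3 := by rw [← hA3, Real.sqrt_sq_eq_abs]
  rw [hA3, show ((3:ℝ) - 1) * (9 - 3) * (3 + 2 * A - 3) / 1024 = 3 / 128 * A by ring, abs_mul, this,
    abs_of_pos (by norm_num)]
  ring

lemma PP_two_lt (x y : ℝ) (h : x ^ 2 + 2 * y ^ 2 = 1) (hB : x ^ 2 - 2 * x * y - 2 * y ^ 2 ≠ 0) :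
    |PP x y y| < 3 * Real.sqrt 3 / 128 := by
  have hA := quad_rel x y h
  rw [PP_two x y h]
  apply bound_all
  have : 0 < (x ^ 2 - 2 * x * y - 2 * y ^ 2) ^ 2 := by positivity
  linarith

lemma PP_two_le (x y : ℝ) (h : x ^ 2 + 2 * y ^ 2 = 1) :
    |PP x y y| ≤ 3 * Real.sqrt 3 / 128 := by
  by_cases hB : x ^ 2 - 2 * x * y - 2 * y ^ 2 = 0
  · exact (PP_two_eq x y h hB).le
  · exact (PP_two_lt x y h hB).le

/-- Monotone form: `27 PP = u (w³ - u³)`. -/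
lemma PP_form (a b c p t w : ℝ) (h : a ^ 2 + b ^ 2 + c ^ 2 = 1) (hp : p = a + b + c)
    (ht : 2 * t = 3 - p ^ 2) (hw : w = 9 * (a * b * c) + p * t) :
    27 * PP a b c = (p * t) * (w ^ 3 - (p * t) ^ 3) := by
  have ht2 : t = a ^ 2 + b ^ 2 + c ^ 2 - (a * b + b * c + c * a) := by
    subst hp; linear_combination ht / 2 - 3 / 2 * h
  subst hw ht2 hp
  unfold PP; ring

lemma disc_id (a b c p t w : ℝ) (h : a ^ 2 + b ^ 2 + c ^ 2 = 1) (hp : p = a + b + c)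
    (ht : 2 * t = 3 - p ^ 2) (hw : w = 9 * (a * b * c) + p * t) :
    4 * t ^ 3 - (3 * w - p ^ 3) ^ 2 = 27 * ((a - b) * (b - c) * (c - a)) ^ 2 := by
  have ht2 : t = a ^ 2 + b ^ 2 + c ^ 2 - (a * b + b * c + c * a) := by
    subst hp; linear_combination ht / 2 - 3 / 2 * h
  subst hw ht2 hp
  ring

/-- A maximizer has two equal coordinates. -/
lemma two_equal (a b c : ℝ) (h : a ^ 2 + b ^ 2 + c ^ 2 = 1)
    (hm : |PP a b c| = 3 * Real.sqrt 3 / 128) : (a - b) * (b - c) * (c - a) = 0 := by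
  by_contra hne
  have hpos : 0 < ((a - b) * (b - c) * (c - a)) ^ 2 := by positivity
  obtain ⟨p, hp⟩ : ∃ p, p = a + b + c := ⟨_, rfl⟩
  obtain ⟨t, ht⟩ : ∃ t, t = (3 - p ^ 2) / 2 := ⟨_, rfl⟩
  obtain ⟨w, hw⟩ : ∃ w, w = 9 * (a * b * c) + p * t := ⟨_, rfl⟩
  have ht' : 2 * t = 3 - p ^ 2 := by linarith
  have ht0 : 0 ≤ t := by
    rw [ht, hp]; nlinarith [sq_nonneg (a - b), sq_nonneg (b - c), sq_nonneg (c - a)]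
  have hdisc := disc_id a b c p t w h hp ht' hw
  have hP := PP_form a b c p t w h hp ht' hw
  obtain ⟨τ, hτ0, hτ⟩ : ∃ τ, 0 ≤ τ ∧ τ ^ 2 = t := ⟨_, Real.sqrt_nonneg t, Real.sq_sqrt ht0⟩
  have hlt : |3 * w - p ^ 3| < 2 * τ ^ 3 := by
    apply abs_lt_of_sq_lt_sq _ (by positivity)
    have : (2 * τ ^ 3) ^ 2 = 4 * t ^ 3 := by rw [← hτ]; ring
    rw [this]; linarith
  rw [abs_lt] at hlt
  have hend : ∀ σ : ℝ, σ ^ 2 = t → |(p * t) * (((p ^ 3 + 2 * σ ^ 3) / 3) ^ 3 - (p * t) ^ 3)|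
      ≤ 27 * (3 * Real.sqrt 3 / 128) := by
    intro σ hσ
    have h1 : ((p + 2 * σ) / 3) ^ 2 + 2 * ((p - σ) / 3) ^ 2 = 1 := by
      linear_combination 2 / 3 * hσ + 1 / 3 * ht'
    have h2 := PP_form ((p + 2 * σ) / 3) ((p - σ) / 3) ((p - σ) / 3) p t
      ((p ^ 3 + 2 * σ ^ 3) / 3) (by linarith) (by ring) ht' (by rw [← hσ]; ring)
    rw [← h2, abs_mul, abs_of_pos (by norm_num : (0:ℝ) < 27)]
    have := PP_two_le _ _ h1
    linarith
  have e1 := hend τ hτ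
  have e2 := hend (-τ) (by rw [← hτ]; ring)
  have mono : StrictMono (fun x : ℝ => x ^ 3) := Odd.strictMono_pow (by decide)
  have m1 : w ^ 3 < ((p ^ 3 + 2 * τ ^ 3) / 3) ^ 3 := mono (by linarith)
  have m2 : ((p ^ 3 + 2 * (-τ) ^ 3) / 3) ^ 3 < w ^ 3 := mono (by
    have : (-τ) ^ 3 = - τ ^ 3 := by ring
    rw [this]; linarith)
  have hs := sqrt3_lo
  rw [abs_le] at e1 e2
  have hfin : |27 * PP a b c| < 27 * (3 * Real.sqrt 3 / 128) := by
    rw [hP, abs_lt]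
    rcases lt_trichotomy (p * t) 0 with hu | hu | hu
    · have n1 := mul_lt_mul_of_neg_left m1 hu
      have n2 := mul_lt_mul_of_neg_left m2 hu
      rw [mul_sub] at e1 e2 ⊢
      constructor <;> linarith
    · rw [hu]; constructor <;> linarith
    · have n1 := mul_lt_mul_of_pos_left m1 hu
      have n2 := mul_lt_mul_of_pos_left m2 hu
      rw [mul_sub] at e1 e2 ⊢
      constructor <;> linarith
  rw [abs_mul, abs_of_pos (by norm_num : (0:ℝ) < 27), hm] at hfin
  exact lt_irrefl _ hfin

lemma multiset_iff (a b c x s : ℝ) : (({a, b, c} : Multiset ℝ) = {x, s, s}) ↔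
    (a = x ∧ b = s ∧ c = s) ∨ (a = s ∧ b = x ∧ c = s) ∨ (a = s ∧ b = s ∧ c = x) := by
  constructor
  · intro h
    have ha : a ∈ ({x, s, s} : Multiset ℝ) := by rw [← h]; simp
    have hb : b ∈ ({x, s, s} : Multiset ℝ) := by rw [← h]; simp
    have hsum := congrArg Multiset.sum h
    simp at ha hb hsum
    have hx : x ∈ ({a, b, c} : Multiset ℝ) := by rw [h]; simp
    simp at hx
    have hs : s ∈ ({a, b, c} : Multiset ℝ) := by rw [h]; simp
    simp at hs
    rcases ha with rfl | rfl <;> rcases hb with rfl | rfl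
    · replace hs : s = b ∨ s = c := by tauto
      rcases hs with rfl | rfl
      · left; refine ⟨rfl, rfl, by linarith⟩
      · left; refine ⟨rfl, by linarith, rfl⟩
    · left; exact ⟨rfl, rfl, by linarith⟩
    · right; left; exact ⟨rfl, rfl, by linarith⟩
    · right; right; exact ⟨rfl, rfl, by linarith⟩
  · rintro (⟨rfl, rfl, rfl⟩ | ⟨rfl, rfl, rfl⟩ | ⟨rfl, rfl, rfl⟩)
    · rfl
    · exact Multiset.cons_swap _ _ _
    · show b ::ₘ b ::ₘ {c} = c ::ₘ b ::ₘ {b}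
      rw [show (b ::ₘ ({c} : Multiset ℝ)) = c ::ₘ {b} from Multiset.cons_swap _ _ 0]
      exact Multiset.cons_swap _ _ _

lemma two_forward (x y : ℝ) (h : x ^ 2 + 2 * y ^ 2 = 1)
    (hm : |PP x y y| = 3 * Real.sqrt 3 / 128) :
    ∃ r s : ℝ, (r = 1 + Real.sqrt 3 ∨ r = 1 - Real.sqrt 3) ∧
      (s = 1 / Real.sqrt (r ^ 2 + 2) ∨ s = -(1 / Real.sqrt (r ^ 2 + 2))) ∧ x = r * s ∧ y = s := by
  have hB : x ^ 2 - 2 * x * y - 2 * y ^ 2 = 0 := by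
    by_contra hB; exact absurd hm (PP_two_lt x y h hB).ne
  have hf : (x - (1 + Real.sqrt 3) * y) * (x - (1 - Real.sqrt 3) * y) = 0 := by
    linear_combination hB - y ^ 2 * sqrt3_sq
  have hy : ∀ r : ℝ, x = r * y →
      (y = 1 / Real.sqrt (r ^ 2 + 2) ∨ y = -(1 / Real.sqrt (r ^ 2 + 2))) := by
    intro r hr
    have hp : 0 < r ^ 2 + 2 := by positivity
    apply sq_eq_sq_iff_eq_or_eq_neg.1
    rw [div_pow, Real.sq_sqrt hp.le, eq_div_iff hp.ne']
    rw [hr] at h; linarith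
  rcases mul_eq_zero.1 hf with h1 | h1
  · exact ⟨_, y, Or.inl rfl, hy _ (by linarith), by linarith, rfl⟩
  · exact ⟨_, y, Or.inr rfl, hy _ (by linarith), by linarith, rfl⟩

lemma two_backward (r s : ℝ) (hr : r = 1 + Real.sqrt 3 ∨ r = 1 - Real.sqrt 3)
    (hs : s = 1 / Real.sqrt (r ^ 2 + 2) ∨ s = -(1 / Real.sqrt (r ^ 2 + 2))) :
    (r * s) ^ 2 + 2 * s ^ 2 = 1 ∧ |PP (r * s) s s| = 3 * Real.sqrt 3 / 128 := by
  have hp : 0 < r ^ 2 + 2 := by positivity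
  have h2 : s ^ 2 = 1 / (r ^ 2 + 2) := by
    rw [sq_eq_sq_iff_eq_or_eq_neg.2 hs, div_pow, Real.sq_sqrt hp.le, one_pow]
  have h1 : (r * s) ^ 2 + 2 * s ^ 2 = 1 := by
    rw [mul_pow, h2]; field_simp
  refine ⟨h1, PP_two_eq _ _ h1 ?_⟩
  have hq : r ^ 2 - 2 * r - 2 = 0 := by
    rcases hr with rfl | rfl <;> linear_combination sqrt3_sq
  linear_combination s ^ 2 * hq

lemma main_iff (a b c : ℝ) (h : a ^ 2 + b ^ 2 + c ^ 2 = 1) :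
      (|D a b c| = Real.sqrt 3 / (2 ^ 19 * 3 ^ 14) ↔
        ∃ r s : ℝ,
          (r = 1 + Real.sqrt 3 ∨ r = 1 - Real.sqrt 3) ∧
          (s = 1 / Real.sqrt (r ^ 2 + 2) ∨ s = -(1 / Real.sqrt (r ^ 2 + 2))) ∧
          ({a, b, c} : Multiset ℝ) = {r * s, s, s}) := by
  rw [absD_iff]
  simp only [multiset_iff]
  constructor
  · intro hm
    rcases mul_eq_zero.1 (two_equal a b c h hm) with h1 | h1
    · rcases mul_eq_zero.1 h1 with h1 | h1
      · have hab : a = b := by linarith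
        subst hab
        rw [PP_swap23, PP_swap12] at hm
        obtain ⟨r, s, hr, hs, h2, h3⟩ := two_forward c a (by linarith) hm
        exact ⟨r, s, hr, hs, Or.inr (Or.inr ⟨h3, h3, h2⟩)⟩
      · have hab : b = c := by linarith
        subst hab
        obtain ⟨r, s, hr, hs, h2, h3⟩ := two_forward a b (by linarith) hm
        exact ⟨r, s, hr, hs, Or.inl ⟨h2, h3, h3⟩⟩
    · have hab : c = a := by linarith
      subst hab
      rw [PP_swap12] at hm
      obtain ⟨r, s, hr, hs, h2, h3⟩ := two_forward b c (by linarith) hm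
      exact ⟨r, s, hr, hs, Or.inr (Or.inl ⟨h3, h2, h3⟩)⟩
  · rintro ⟨r, s, hr, hs, (⟨rfl, rfl, rfl⟩ | ⟨rfl, rfl, rfl⟩ | ⟨rfl, rfl, rfl⟩)⟩
    · exact (two_backward _ _ hr hs).2
    · rw [PP_swap12]; exact (two_backward _ _ hr hs).2
    · rw [PP_swap23, PP_swap12]; exact (two_backward _ _ hr hs).2

/-- The points `(x, s, s)`, `(s, x, s)`, `(s, s, x)`. -/
def perms3 (x s : ℝ) : Set (ℝ × ℝ × ℝ) := {(x, s, s), (s, x, s), (s, s, x)}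

lemma perms3_ncard (x s : ℝ) (h : x ≠ s) : (perms3 x s).ncard = 3 := by
  unfold perms3
  rw [Set.ncard_eq_three]
  refine ⟨_, _, _, ?_, ?_, ?_, rfl⟩ <;> simp [h, h.symm]

lemma perms3_finite (x s : ℝ) : (perms3 x s).Finite := by
  unfold perms3; exact Set.toFinite _

lemma perms3_disj (x s y v : ℝ) (h : s ≠ v) (h' : x ≠ v) : Disjoint (perms3 x s) (perms3 y v) := by
  rw [Set.disjoint_left]
  rintro ⟨p, q, r⟩ h1 h2
  simp only [perms3, Set.mem_insert_iff, Set.mem_singleton_iff, Prod.mk.injEq] at h1 h2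
  rcases h1 with ⟨rfl, rfl, rfl⟩ | ⟨rfl, rfl, rfl⟩ | ⟨rfl, rfl, rfl⟩ <;>
    rcases h2 with ⟨h3, h4, h5⟩ | ⟨h3, h4, h5⟩ | ⟨h3, h4, h5⟩ <;> simp_all

lemma ncard_four (α β γ δ : ℝ) (h0 : 0 < α) (h1 : α < β) (h2 : β < γ) (h3 : γ < δ) :
    (perms3 δ α ∪ perms3 (-δ) (-α) ∪ (perms3 (-β) γ ∪ perms3 β (-γ))).ncard = 12 := by
  rw [Set.ncard_union_eq _ ((perms3_finite _ _).union (perms3_finite _ _))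
      ((perms3_finite _ _).union (perms3_finite _ _)),
    Set.ncard_union_eq _ (perms3_finite _ _) (perms3_finite _ _),
    Set.ncard_union_eq _ (perms3_finite _ _) (perms3_finite _ _),
    perms3_ncard, perms3_ncard, perms3_ncard, perms3_ncard]
  · intro h; linarith
  · intro h; linarith
  · intro h; linarith
  · intro h; linarith
  · apply perms3_disj <;> intro h <;> linarith
  · apply perms3_disj <;> intro h <;> linarith
  · rw [Set.disjoint_union_left, Set.disjoint_union_right, Set.disjoint_union_right]
    refine ⟨⟨?_, ?_⟩, ?_, ?_⟩ <;> apply perms3_disj <;> intro h <;> linarith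

theorem abs_D_eq_max_iff :
    (∀ a b c : ℝ, a ^ 2 + b ^ 2 + c ^ 2 = 1 →
      (|D a b c| = Real.sqrt 3 / (2 ^ 19 * 3 ^ 14) ↔
        ∃ r s : ℝ,
          (r = 1 + Real.sqrt 3 ∨ r = 1 - Real.sqrt 3) ∧
          (s = 1 / Real.sqrt (r ^ 2 + 2) ∨ s = -(1 / Real.sqrt (r ^ 2 + 2))) ∧
          ({a, b, c} : Multiset ℝ) = {r * s, s, s})) ∧
    Set.ncard {p : ℝ × ℝ × ℝ |
      p.1 ^ 2 + p.2.1 ^ 2 + p.2.2 ^ 2 = 1 ∧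
      |D p.1 p.2.1 p.2.2| = Real.sqrt 3 / (2 ^ 19 * 3 ^ 14)} = 12 := by
  refine ⟨main_iff, ?_⟩
  have hl := sqrt3_lo
  have hh := sqrt3_hi
  have hq := sqrt3_sq
  obtain ⟨r1, hr1⟩ : ∃ r, r = 1 + Real.sqrt 3 := ⟨_, rfl⟩
  obtain ⟨r2, hr2⟩ : ∃ r, r = 1 - Real.sqrt 3 := ⟨_, rfl⟩
  obtain ⟨s1, hs1⟩ : ∃ s, s = 1 / Real.sqrt (r1 ^ 2 + 2) := ⟨_, rfl⟩
  obtain ⟨s2, hs2⟩ : ∃ s, s = 1 / Real.sqrt (r2 ^ 2 + 2) := ⟨_, rfl⟩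
  have p1 : 0 < s1 := by rw [hs1]; positivity
  have p2 : 0 < s2 := by rw [hs2]; positivity
  have q1 := (two_backward r1 s1 (Or.inl hr1) (Or.inl hs1)).1
  have q2 := (two_backward r2 s2 (Or.inr hr2) (Or.inl hs2)).1
  have b1 : 2.73 < r1 := by linarith
  have b1' : r1 < 2.74 := by linarith
  have b2 : r2 < -0.73 := by linarith
  have b2' : -0.74 < r2 := by linarith
  have u1 : s1 ^ 2 * (6 + 2 * Real.sqrt 3) = 1 := by
    rw [hr1] at q1; linear_combination q1 - s1 ^ 2 * hq
  have u2 : s2 ^ 2 * (6 - 2 * Real.sqrt 3) = 1 := by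
    rw [hr2] at q2; linear_combination q2 - s2 ^ 2 * hq
  have c1 : s1 < 0.33 := by
    by_contra hc
    have : (0.33:ℝ) ^ 2 ≤ s1 ^ 2 := pow_le_pow_left₀ (by norm_num) (not_lt.1 hc) 2
    nlinarith
  have c1' : 0.32 < s1 := by
    by_contra hc
    have : s1 ^ 2 ≤ (0.32:ℝ) ^ 2 := pow_le_pow_left₀ p1.le (not_lt.1 hc) 2
    nlinarith
  have c2 : s2 < 0.64 := by
    by_contra hc
    have : (0.64:ℝ) ^ 2 ≤ s2 ^ 2 := pow_le_pow_left₀ (by norm_num) (not_lt.1 hc) 2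
    nlinarith
  have c2' : 0.62 < s2 := by
    by_contra hc
    have : s2 ^ 2 ≤ (0.62:ℝ) ^ 2 := pow_le_pow_left₀ p2.le (not_lt.1 hc) 2
    nlinarith
  have hcard := ncard_four s1 (-(r2 * s2)) s2 (r1 * s1) p1 (by nlinarith) (by nlinarith)
    (by nlinarith)
  rw [← hcard]
  congr 1
  ext ⟨a, b, c⟩
  simp only [Set.mem_ofPred_eq, Set.mem_union, perms3, Set.mem_insert_iff, Set.mem_singleton_iff,
    Prod.mk.injEq, neg_neg]
  constructor
  · rintro ⟨h1, h2⟩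
    rw [main_iff a b c h1] at h2
    obtain ⟨r, s, hr, hs, hm⟩ := h2
    rw [multiset_iff] at hm
    rw [← hr1, ← hr2] at hr
    rcases hr with rfl | rfl
    · rw [← hs1] at hs
      rcases hs with rfl | rfl
      · exact Or.inl (Or.inl hm)
      · rw [mul_neg] at hm; exact Or.inl (Or.inr hm)
    · rw [← hs2] at hs
      rcases hs with rfl | rfl
      · exact Or.inr (Or.inl hm)
      · rw [mul_neg] at hm; exact Or.inr (Or.inr hm)
  · intro h
    have main : ∃ r s : ℝ, (r = 1 + Real.sqrt 3 ∨ r = 1 - Real.sqrt 3) ∧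
          (s = 1 / Real.sqrt (r ^ 2 + 2) ∨ s = -(1 / Real.sqrt (r ^ 2 + 2))) ∧
          ((a = r * s ∧ b = s ∧ c = s) ∨ (a = s ∧ b = r * s ∧ c = s) ∨
            (a = s ∧ b = s ∧ c = r * s)) := by
      rcases h with (h | h) | (h | h)
      · exact ⟨r1, s1, Or.inl hr1, Or.inl hs1, h⟩
      · exact ⟨r1, -s1, Or.inl hr1, Or.inr (by rw [hs1]), by rw [mul_neg]; exact h⟩
      · exact ⟨r2, s2, Or.inr hr2, Or.inl hs2, h⟩
      · exact ⟨r2, -s2, Or.inr hr2, Or.inr (by rw [hs2]), by rw [mul_neg]; exact h⟩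
    obtain ⟨r, s, hr, hs, hm⟩ := main
    have h1 : a ^ 2 + b ^ 2 + c ^ 2 = 1 := by
      have := (two_backward r s hr hs).1
      rcases hm with ⟨rfl, rfl, rfl⟩ | ⟨rfl, rfl, rfl⟩ | ⟨rfl, rfl, rfl⟩ <;> linarith
    exact ⟨h1, (main_iff a b c h1).2 ⟨r, s, hr, hs, (multiset_iff _ _ _ _ _).2 hm⟩⟩
end

section
/- For all real numbers a, b, c with a² + b² + c² = 1, the absolute value of I₉(a,b,c) is at most √6/3888. (This is the global maximum of the absolute value of the degree-9 fundamental SLOCC invariant restricted to real semi-simple 3-qutrit states.) -/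
/-- Restriction of the degree-9 fundamental invariant to normalized semi-simple states. -/
noncomputable def I₉ (a b c : ℝ) : ℝ :=
  -(Real.sqrt 3 / 243) * (a - b) * (a - c) * (b - c) *
    (a ^ 2 + a * b + b ^ 2) * (a ^ 2 + a * c + c ^ 2) * (b ^ 2 + b * c + c ^ 2)

lemma aux_poly (C W G : ℝ) (hC : 0 ≤ C) (hCW : C ≤ W) (hW : W ≤ 1) (hG : 0 ≤ G)
    (h : G ≤ (1 - W) ^ 3 + 2 * C * W * (3 - 2 * C - W) - 8 * C ^ 3) :
    (4 - C - W) * (1 + W - 2 * C) * G ≤ 4 := by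
  have hW0 : 0 ≤ W := hC.trans hCW
  have h1 : (4 - C - W) * (1 + W - 2 * C) ≤ (4 - W) * (1 + W) := by nlinarith
  have h2 : C ^ 3 ≥ 3 * C * (W / 4) ^ 2 - 2 * (W / 4) ^ 3 := by
    have : 0 ≤ (C - W / 4) ^ 2 * (C + 2 * (W / 4)) := by positivity
    nlinarith
  have h3 : G ≤ (1 - W) ^ 3 + W ^ 3 / 4 + W * (6 - 7 / 2 * W) ^ 2 / 16 := by
    have : 0 ≤ W * (2 * C - (6 - 7 / 2 * W) / 4) ^ 2 := by positivity
    nlinarith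
  have h4 : 0 ≤ (4 - W) * (1 + W) := by nlinarith
  have h5 : 0 ≤ W ^ 2 * (28 - 31 * W + (21 / 4) * W ^ 2 + (1 / 4) * W ^ 3) := by
    have : 0 ≤ 28 - 31 * W + (21 / 4) * W ^ 2 + (1 / 4) * W ^ 3 := by
      have : 0 ≤ W ^ 3 := by positivity
      nlinarith
    positivity
  calc _ ≤ (4 - W) * (1 + W) * G := mul_le_mul_of_nonneg_right h1 hG
    _ ≤ _ := mul_le_mul_of_nonneg_left h3 h4
    _ ≤ 4 := by nlinarith

lemma aux_core (a c d : ℝ) (ha : 0 ≤ a) (hc : 0 ≤ c) (hd : 0 ≤ d)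
    (h : a ^ 2 + c ^ 2 + d ^ 2 = 1) :
    (a ^ 3 + d ^ 3) * ((a ^ 3 - c ^ 3) * (c ^ 3 + d ^ 3)) ≤ Real.sqrt 2 / 16 := by
  obtain ⟨r, hr⟩ : ∃ r, r = Real.sqrt 2 := ⟨_, rfl⟩
  have hr0 : 0 ≤ r := hr ▸ Real.sqrt_nonneg 2
  have hr2 : r ^ 2 = 2 := by rw [hr]; exact Real.sq_sqrt (by norm_num)
  rw [← hr]
  have had : 0 ≤ a ^ 3 + d ^ 3 := by positivity
  rcases le_total ((a ^ 3 - c ^ 3) * (c ^ 3 + d ^ 3)) 0 with hT | hT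
  · have := mul_nonpos_of_nonneg_of_nonpos had hT
    linarith
  have hp : 0 ≤ a * d := mul_nonneg ha hd
  have hk : 0 ≤ c ^ 2 * (c - (a - d)) ^ 2 * (a ^ 2 + d ^ 2 + a * d) := by positivity
  have key := aux_poly (c ^ 2) (c ^ 2 + (a - d) ^ 2)
    (8 * ((a ^ 3 - c ^ 3) * (c ^ 3 + d ^ 3))) (by positivity)
    (by nlinarith [sq_nonneg (a - d)]) (by nlinarith) (by linarith) (by
      have e1 : 1 - (c ^ 2 + (a - d) ^ 2) = 2 * (a * d) := by linarith
      have e2 : 3 - 2 * c ^ 2 - (c ^ 2 + (a - d) ^ 2) = 2 * (a ^ 2 + d ^ 2 + a * d) := by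
        linarith
      rw [e1, e2]
      linarith)
  have e3 : 4 - c ^ 2 - (c ^ 2 + (a - d) ^ 2) = (a + d) ^ 2 + 2 := by linarith
  have e4 : 1 + (c ^ 2 + (a - d) ^ 2) - 2 * c ^ 2 = 2 * (a ^ 2 + d ^ 2 - a * d) := by linarith
  rw [e3, e4] at key
  have hs : a + d ≤ r * ((a + d) ^ 2 + 2) / 4 := by
    have : 0 ≤ r * (a + d - r) ^ 2 := by positivity
    have e : r * (a + d - r) ^ 2 = r * (a + d) ^ 2 - 2 * r ^ 2 * (a + d) + r * r ^ 2 := by ring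
    rw [e, hr2] at this
    linarith
  have hq : 0 ≤ a ^ 2 + d ^ 2 - a * d := by nlinarith [sq_nonneg (a - d)]
  have h1 := mul_le_mul_of_nonneg_right hs (mul_nonneg hq hT)
  have h2 := mul_le_mul_of_nonneg_left key hr0
  linarith

lemma aux_core_abs (a c d : ℝ) (ha : 0 ≤ a) (hc : 0 ≤ c) (hd : 0 ≤ d)
    (h : a ^ 2 + c ^ 2 + d ^ 2 = 1) :
    (a ^ 3 + d ^ 3) * (|a ^ 3 - c ^ 3| * (c ^ 3 + d ^ 3)) ≤ Real.sqrt 2 / 16 := by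
  rcases abs_cases (a ^ 3 - c ^ 3) with ⟨e, _⟩ | ⟨e, _⟩
  · rw [e]; exact aux_core a c d ha hc hd h
  · rw [e]; have := aux_core c a d hc ha hd (by linarith)
    linarith

lemma aux_same (a b c : ℝ) (hab : 0 ≤ a * b) (h : a ^ 2 + b ^ 2 + c ^ 2 = 1) :
    |(a ^ 3 - b ^ 3) * (a ^ 3 - c ^ 3) * (b ^ 3 - c ^ 3)| ≤ Real.sqrt 2 / 16 := by
  have key := aux_core_abs |a| |b| |c| (abs_nonneg _) (abs_nonneg _) (abs_nonneg _)
    (by simpa only [sq_abs] using h)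
  have e : |(|a| ^ 3 - |b| ^ 3)| = |a ^ 3 - b ^ 3| := by
    rcases mul_nonneg_iff.1 hab with ⟨h1, h2⟩ | ⟨h1, h2⟩
    · rw [abs_of_nonneg h1, abs_of_nonneg h2]
    · rw [abs_of_nonpos h1, abs_of_nonpos h2, ← abs_neg]
      congr 1; ring
  have h1 : |a ^ 3 - c ^ 3| ≤ |a| ^ 3 + |c| ^ 3 := by
    rw [← abs_pow, ← abs_pow]; exact abs_sub (a ^ 3) (c ^ 3)
  have h2 : |b ^ 3 - c ^ 3| ≤ |b| ^ 3 + |c| ^ 3 := by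
    rw [← abs_pow, ← abs_pow]; exact abs_sub (b ^ 3) (c ^ 3)
  rw [e] at key
  refine le_trans ?_ key
  rw [abs_mul, abs_mul, mul_comm |a ^ 3 - b ^ 3|, mul_assoc]
  gcongr

lemma aux_all (a b c : ℝ) (h : a ^ 2 + b ^ 2 + c ^ 2 = 1) :
    |(a ^ 3 - b ^ 3) * (a ^ 3 - c ^ 3) * (b ^ 3 - c ^ 3)| ≤ Real.sqrt 2 / 16 := by
  by_cases hab : 0 ≤ a * b
  · exact aux_same a b c hab h
  by_cases hac : 0 ≤ a * c
  · have := aux_same a c b hac (by linarith)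
    rw [← abs_neg]
    convert this using 2
    ring
  have hbc : 0 ≤ b * c := by
    by_contra hbc
    push Not at hab hac hbc
    have h1 := mul_pos_of_neg_of_neg hab hac
    have h2 := mul_neg_of_pos_of_neg h1 hbc
    nlinarith [sq_nonneg (a * b * c)]
  have := aux_same b c a hbc (by linarith)
  convert this using 2
  ring

/-- The global maximum of `|I₉|` on real semi-simple 3-qutrit states is `√6/3888`. -/
theorem abs_I₉_le (a b c : ℝ) (h : a ^ 2 + b ^ 2 + c ^ 2 = 1) :
    |I₉ a b c| ≤ Real.sqrt 6 / 3888 := by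
  have key := aux_all a b c h
  have e : I₉ a b c = -(Real.sqrt 3 / 243) *
      ((a ^ 3 - b ^ 3) * (a ^ 3 - c ^ 3) * (b ^ 3 - c ^ 3)) := by
    unfold I₉; ring
  have h6 : Real.sqrt 6 = Real.sqrt 3 * Real.sqrt 2 := by
    rw [← Real.sqrt_mul (by norm_num)]; norm_num
  have h3 : 0 ≤ Real.sqrt 3 / 243 := by positivity
  rw [e, abs_mul, abs_neg, abs_of_nonneg h3, h6]
  have := mul_le_mul_of_nonneg_left key h3
  linarith
end

section
/- For real numbers a, b, c with a² + b² + c² = 1, one has |I₁₂(a,b,c)| = 1/7776 if and only if (a,b,c) is a permutation of (1/√2, −1/√2, 0). -/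
/-- Restriction of the degree-12 fundamental invariant to normalized semi-simple states. -/
noncomputable def I₁₂ (a b c : ℝ) : ℝ :=
  (1 / 729) * (a ^ 9 * b ^ 3 + a ^ 3 * b ^ 9 + a ^ 9 * c ^ 3 + b ^ 9 * c ^ 3 +
    a ^ 3 * c ^ 9 + b ^ 3 * c ^ 9 -
    4 * (a ^ 6 * b ^ 6 + a ^ 6 * c ^ 6 + b ^ 6 * c ^ 6) +
    2 * (a ^ 6 * b ^ 3 * c ^ 3 + a ^ 3 * b ^ 6 * c ^ 3 + a ^ 3 * b ^ 3 * c ^ 6))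


/-- The square-root-free polynomial `729 * I₁₂`. -/
lemma I12_e (a b c : ℝ) : 729 * I₁₂ a b c =
    (a^3+b^3+c^3)^2 * (a^3*b^3+b^3*c^3+c^3*a^3) - 6 * (a^3*b^3+b^3*c^3+c^3*a^3)^2
      + 9 * (a^3+b^3+c^3) * (a*b*c)^3 := by
  unfold I₁₂; ring

lemma I12_pr (a b c : ℝ) (h : a ^ 2 + b ^ 2 + c ^ 2 = 1) (p r P : ℝ) (hp : p = a + b + c)
    (hr : r = a*b*c) (hP : P = p^2) :
    729 * I₁₂ a b c + 3/32 = 27 * (p*r)^3 + (27-27*P+117*P^2-93*P^3)/8 * r^2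
      + 3*(1-P)*(3-2*P+7*P^2-4*P^3)/8 * (p*r)
      + P * ((3*(6-15*P+20*P^2-15*P^3+6*P^4-P^5) - (3-P)^2*(1-P)^3)/32) := by
  have hq : a*b+b*c+c*a = (p^2-1)/2 := by rw [hp]; linarith
  have e1 : a^3+b^3+c^3 = p^3-3*p*((p^2-1)/2)+3*r := by
    rw [← hq, hp, hr]; ring
  have e2 : a^3*b^3+b^3*c^3+c^3*a^3 = ((p^2-1)/2)^3-3*p*((p^2-1)/2)*r+3*r^2 := by
    rw [← hq, hp, hr]; ring
  rw [I12_e, e1, e2, ← hr, hP]; ring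

lemma quad_pos {p r P w K L c C : ℝ} (hP : P = p^2) (hw : w = p*r) (hL : 0 < L)
    (hK : L < K) (hC : c^2 < 4 * L * C) (hle : K * r^2 + c * w + P * C ≤ 0) : p = 0 ∧ r = 0 := by
  have h1 : 4*L*(K * r^2 + c * w + P * C) =
      (2*L*r + c*p)^2 + 4*L*(K-L)*r^2 + (4*L*C-c^2)*p^2 := by
    rw [hP, hw]; ring
  have h2 : 4*L*(K * r^2 + c * w + P * C) ≤ 0 := by nlinarith
  have h3 : 0 < 4*L*(K-L) := by have : 0 < K - L := by linarith
                                positivity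
  have h4 : 0 < 4*L*C-c^2 := by linarith
  have h5 : 4*L*(K-L)*r^2 ≥ 0 := by positivity
  have h6 : (4*L*C-c^2)*p^2 ≥ 0 := by positivity
  have h7 := sq_nonneg (2*L*r + c*p)
  constructor
  · have : (4*L*C-c^2)*p^2 = 0 := by linarith
    have := (mul_eq_zero.1 this).resolve_left h4.ne'
    exact pow_eq_zero_iff (two_ne_zero) |>.1 this
  · have : 4*L*(K-L)*r^2 = 0 := by linarith
    have := (mul_eq_zero.1 this).resolve_left h3.ne'
    exact pow_eq_zero_iff (two_ne_zero) |>.1 this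

lemma bern {x l u : ℝ} (hl : l ≤ x) (hu : x ≤ u) (i j : ℕ) : 0 ≤ (x-l)^i * (u-x)^j :=
  mul_nonneg (pow_nonneg (sub_nonneg.2 hl) i) (pow_nonneg (sub_nonneg.2 hu) j)

lemma small_P (p r P w : ℝ) (hP : P = p^2) (hw : w = p*r) (hP1 : P ≤ 1)
    (hr : r^2 ≤ 1/27) (hw6 : -(1/6) ≤ w)
    (hle : 27 * w^3 + (27-27*P+117*P^2-93*P^3)/8 * r^2
      + 3*(1-P)*(3-2*P+7*P^2-4*P^3)/8 * w
      + P * ((3*(6-15*P+20*P^2-15*P^3+6*P^4-P^5) - (3-P)^2*(1-P)^3)/32) ≤ 0) :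
    p = 0 ∧ r = 0 := by
  have hP0 : 0 ≤ P := by rw [hP]; positivity
  have hr0 : 0 ≤ r^2 := by positivity
  have hw2 : w^2 = P*r^2 := by rw [hw, hP]; ring
  have hw3 : 27 * w^3 ≥ -(9/2) * P * r^2 := by
    have : 0 ≤ w^2 * (w + 1/6) := mul_nonneg (sq_nonneg _) (by linarith)
    nlinarith
  have hle2 : ((27-27*P+117*P^2-93*P^3)/8 - 9/2*P) * r^2
      + 3*(1-P)*(3-2*P+7*P^2-4*P^3)/8 * w
      + P * ((3*(6-15*P+20*P^2-15*P^3+6*P^4-P^5) - (3-P)^2*(1-P)^3)/32) ≤ 0 := by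
    linarith
  have hc : 0 ≤ 3*(1-P)*(3-2*P+7*P^2-4*P^3)/8 := by
    have : 0 ≤ 3-2*P+7*P^2-4*P^3 := by nlinarith [mul_nonneg hP0 (sub_nonneg.2 hP1), mul_nonneg (mul_nonneg hP0 hP0) (sub_nonneg.2 hP1)]
    have : 0 ≤ (1-P) * (3-2*P+7*P^2-4*P^3) := mul_nonneg (by linarith) this
    linarith
  by_cases h8 : 4/5 ≤ P
  · exfalso
    obtain ⟨u, rfl⟩ : ∃ u, P = 1 - u := ⟨1-P, by ring⟩
    have hu0 : 0 ≤ u := by linarith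
    have hu1 : u ≤ 1/5 := by linarith
    have hcw : 3*(1-(1-u))*(3-2*(1-u)+7*(1-u)^2-4*(1-u)^3)/8 * w ≥ 3*(1-(1-u))*(3-2*(1-u)+7*(1-u)^2-4*(1-u)^3)/8 * (-(1/6)) := by
      exact mul_le_mul_of_nonneg_left hw6 hc
    have h1 : 0 < 3*(1-(1-u))*(3-2*(1-u)+7*(1-u)^2-4*(1-u)^3)/8 * (-(1/6)) + (1-u) * ((3*(6-15*(1-u)+20*(1-u)^2-15*(1-u)^3+6*(1-u)^4-(1-u)^5) - (3-(1-u))^2*(1-(1-u))^3)/32) := by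
      linarith [bern hu0 (hu1) 0 6, bern hu0 (hu1) 1 5, bern hu0 (hu1) 2 4, bern hu0 (hu1) 3 3, bern hu0 (hu1) 4 2, bern hu0 (hu1) 5 1, bern hu0 (hu1) 6 0]
    have h2 : 0 < ((27-27*(1-u)+117*(1-u)^2-93*(1-u)^3)/8 - 9/2*(1-u)) * (1/27) + 3*(1-(1-u))*(3-2*(1-u)+7*(1-u)^2-4*(1-u)^3)/8 * (-(1/6)) + (1-u) * ((3*(6-15*(1-u)+20*(1-u)^2-15*(1-u)^3+6*(1-u)^4-(1-u)^5) - (3-(1-u))^2*(1-(1-u))^3)/32) := by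
      linarith [bern hu0 (hu1) 0 6, bern hu0 (hu1) 1 5, bern hu0 (hu1) 2 4, bern hu0 (hu1) 3 3, bern hu0 (hu1) 4 2, bern hu0 (hu1) 5 1, bern hu0 (hu1) 6 0]
    rcases le_total 0 ((27-27*(1-u)+117*(1-u)^2-93*(1-u)^3)/8 - 9/2*(1-u)) with hK | hK
    · have := mul_nonneg hK hr0
      linarith
    · have := mul_le_mul_of_nonpos_left hr hK
      linarith
  · push Not at h8
    rcases le_total P (2/5) with h4 | h4
    · refine quad_pos (L := 9/5) hP hw (by norm_num) ?_ ?_ hle2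
      · linarith [bern hP0 (h4) 0 3, bern hP0 (h4) 1 2, bern hP0 (h4) 2 1, bern hP0 (h4) 3 0]
      · linarith [bern hP0 (h4) 0 8, bern hP0 (h4) 1 7, bern hP0 (h4) 2 6, bern hP0 (h4) 3 5, bern hP0 (h4) 4 4, bern hP0 (h4) 5 3, bern hP0 (h4) 6 2, bern hP0 (h4) 7 1, bern hP0 (h4) 8 0]
    rcases le_total P (13/20) with h65 | h65
    · refine quad_pos (L := 31/25) hP hw (by norm_num) ?_ ?_ hle2
      · linarith [bern h4 (h65) 0 3, bern h4 (h65) 1 2, bern h4 (h65) 2 1, bern h4 (h65) 3 0]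
      · linarith [bern h4 (h65) 0 8, bern h4 (h65) 1 7, bern h4 (h65) 2 6, bern h4 (h65) 3 5, bern h4 (h65) 4 4, bern h4 (h65) 5 3, bern h4 (h65) 6 2, bern h4 (h65) 7 1, bern h4 (h65) 8 0]
    · refine quad_pos (L := 12/25) hP hw (by norm_num) ?_ ?_ hle2
      · linarith [bern h65 (h8.le) 0 3, bern h65 (h8.le) 1 2, bern h65 (h8.le) 2 1, bern h65 (h8.le) 3 0]
      · linarith [bern h65 (h8.le) 0 8, bern h65 (h8.le) 1 7, bern h65 (h8.le) 2 6, bern h65 (h8.le) 3 5, bern h65 (h8.le) 4 4, bern h65 (h8.le) 5 3, bern h65 (h8.le) 6 2, bern h65 (h8.le) 7 1, bern h65 (h8.le) 8 0]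

lemma sum_sq_prod (a b c : ℝ) (h : a ^ 2 + b ^ 2 + c ^ 2 = 1) :
    (a*b)^2 + (b*c)^2 + (c*a)^2 ≤ 1/3 := by
  have : (a^2+b^2+c^2)^2 = 1 := by rw [h]; norm_num
  nlinarith [sq_nonneg (a^2-b^2), sq_nonneg (b^2-c^2), sq_nonneg (c^2-a^2)]

lemma r_sq (a b c : ℝ) (h : a ^ 2 + b ^ 2 + c ^ 2 = 1) : (a*b*c)^2 ≤ 1/27 := by
  have h1 := sum_sq_prod a b c h
  have h2 : 3 * (a*b*c)^2 * (a^2+b^2+c^2) ≤ ((a*b)^2 + (b*c)^2 + (c*a)^2)^2 := by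
    nlinarith [sq_nonneg ((a*b)^2-(b*c)^2), sq_nonneg ((b*c)^2-(c*a)^2), sq_nonneg ((c*a)^2-(a*b)^2)]
  rw [h] at h2
  have h3 : 0 ≤ (a*b)^2 + (b*c)^2 + (c*a)^2 := by positivity
  nlinarith

lemma e1_sq (a b c : ℝ) (h : a ^ 2 + b ^ 2 + c ^ 2 = 1) : (a^3+b^3+c^3)^2 ≤ 1 := by
  have ha : a^2 ≤ 1 := by nlinarith [sq_nonneg b, sq_nonneg c]
  have hb : b^2 ≤ 1 := by nlinarith [sq_nonneg a, sq_nonneg c]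
  have hc : c^2 ≤ 1 := by nlinarith [sq_nonneg b, sq_nonneg a]
  have ha' := abs_le.1 (abs_le_one_iff_mul_self_le_one.2 (by nlinarith : a*a ≤ 1))
  have hb' := abs_le.1 (abs_le_one_iff_mul_self_le_one.2 (by nlinarith : b*b ≤ 1))
  have hc' := abs_le.1 (abs_le_one_iff_mul_self_le_one.2 (by nlinarith : c*c ≤ 1))
  rw [sq_le_one_iff_abs_le_one, abs_le]
  constructor
  · nlinarith [mul_nonneg (sq_nonneg a) (by linarith : 0 ≤ a+1), mul_nonneg (sq_nonneg b) (by linarith : 0 ≤ b+1), mul_nonneg (sq_nonneg c) (by linarith : 0 ≤ c+1)]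
  · nlinarith [mul_nonneg (sq_nonneg a) (by linarith : 0 ≤ 1-a), mul_nonneg (sq_nonneg b) (by linarith : 0 ≤ 1-b), mul_nonneg (sq_nonneg c) (by linarith : 0 ≤ 1-c)]

lemma upper (a b c : ℝ) (h : a ^ 2 + b ^ 2 + c ^ 2 = 1) : 729 * I₁₂ a b c < 3/32 := by
  have h1 := e1_sq a b c h
  rw [I12_e]
  have h2 : 3 * (a^3+b^3+c^3) * (a*b*c)^3 ≤ (a^3*b^3+b^3*c^3+c^3*a^3)^2 := by
    nlinarith [sq_nonneg (a^3*b^3-b^3*c^3), sq_nonneg (b^3*c^3-c^3*a^3), sq_nonneg (c^3*a^3-a^3*b^3)]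
  generalize (a^3*b^3+b^3*c^3+c^3*a^3) = y at *
  generalize (a^3+b^3+c^3) = x at *
  nlinarith [sq_nonneg (x^2 - 6*y), sq_nonneg x, mul_self_nonneg (x^2)]

lemma prod_le (a b c : ℝ) (h : a ^ 2 + b ^ 2 + c ^ 2 = 1) : a*b ≤ 1/2 := by
  nlinarith [sq_nonneg (a-b), sq_nonneg c]

lemma cube_le {x : ℝ} (h : x ≤ 1/2) : x^3 ≤ 1/8 := by
  nlinarith [sq_nonneg (x+1/2), mul_nonneg (by linarith : 0 ≤ 1/2 - x) (sq_nonneg (x+1/4))]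

lemma e2_le {x y z : ℝ} (hx : x ≤ 1/2) (hy : y ≤ 1/2) (hz : z ≤ 1/2) (h : x*y+y*z+z*x < 0)
    (h3 : 0 ≤ x*y*z) : x^3+y^3+z^3 ≤ 1/8 := by
  have n3 : ∀ {t : ℝ}, t ≤ 0 → t^3 ≤ 0 := fun {t} ht => by
    have := mul_nonneg (neg_nonneg.2 ht) (sq_nonneg t); nlinarith
  have a := cube_le hx
  have b := cube_le hy
  have c := cube_le hz
  rcases le_or_gt x 0 with h1 | h1 <;> rcases le_or_gt y 0 with h2 | h2 <;>
    rcases le_or_gt z 0 with h4 | h4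
  · linarith [n3 h1, n3 h2, n3 h4]
  · linarith [n3 h1, n3 h2]
  · linarith [n3 h1, n3 h4]
  · have : x * (y*z) = 0 := by nlinarith [mul_pos h2 h4]
    have : x = 0 := (mul_eq_zero.1 this).resolve_right (mul_pos h2 h4).ne'
    subst this; nlinarith [mul_pos h2 h4]
  · linarith [n3 h2, n3 h4]
  · have : y * (x*z) = 0 := by nlinarith [mul_pos h1 h4]
    have : y = 0 := (mul_eq_zero.1 this).resolve_right (mul_pos h1 h4).ne'
    subst this; nlinarith [mul_pos h1 h4]
  · have : z * (x*y) = 0 := by nlinarith [mul_pos h1 h2]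
    have : z = 0 := (mul_eq_zero.1 this).resolve_right (mul_pos h1 h2).ne'
    subst this; nlinarith [mul_pos h1 h2]
  · nlinarith [mul_pos h1 h2, mul_pos h2 h4, mul_pos h1 h4]

lemma cubes_le {x y z : ℝ} (hx : x ≤ 1/2) (hy : y ≤ 1/2) (hz : z ≤ 1/2)
    (h : x^2+y^2+z^2 ≤ 1/3) : x^3+y^3+z^3 ≤ 1/6 := by
  nlinarith [mul_nonneg (sq_nonneg x) (sub_nonneg.2 hx), mul_nonneg (sq_nonneg y) (sub_nonneg.2 hy),
    mul_nonneg (sq_nonneg z) (sub_nonneg.2 hz)]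

lemma fin1 {y z : ℝ} (h0 : 0 ≤ y) (h1 : y ≤ 1/6) (hz : 0 ≤ z) : -(3/32) < -3*y^2 + 9*z := by
  nlinarith

lemma fin2 {y z : ℝ} (h0 : 0 ≤ y) (h1 : y ≤ 1/8) (hz : -(1/216) ≤ z) :
    -(3/32) < -3*y^2 + 9*z := by
  nlinarith

lemma large_P (a b c : ℝ) (h : a ^ 2 + b ^ 2 + c ^ 2 = 1) (hP : 1 ≤ (a+b+c)^2) :
    -(3/32) < 729 * I₁₂ a b c := by
  have hq : 0 ≤ a*b+b*c+c*a := by nlinarith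
  have hM := sum_sq_prod a b c h
  have hab := prod_le a b c h
  have hbc := prod_le b c a (by linarith)
  have hca := prod_le c a b (by linarith)
  have hE := e1_sq a b c h
  have e2n : 0 ≤ a^3*b^3+b^3*c^3+c^3*a^3 := by
    have : a^3*b^3+b^3*c^3+c^3*a^3 = (a*b+b*c+c*a) *
      (((a*b-b*c)^2+(b*c-c*a)^2+(c*a-a*b)^2)/2) + 3*(a*b*c)^2 := by ring
    rw [this]; positivity
  have e12 : 3 * (a^3*b^3+b^3*c^3+c^3*a^3) ≤ (a^3+b^3+c^3)^2 := by
    nlinarith [sq_nonneg (a^3-b^3), sq_nonneg (b^3-c^3), sq_nonneg (c^3-a^3)]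
  have hJ : -3 * (a^3*b^3+b^3*c^3+c^3*a^3)^2 + 9 * ((a^3+b^3+c^3) * (a*b*c)^3) ≤ 729 * I₁₂ a b c := by
    rw [I12_e]; nlinarith [mul_nonneg e2n (sub_nonneg.2 e12)]
  have hcub : a^3*b^3+b^3*c^3+c^3*a^3 = (a*b)^3+(b*c)^3+(c*a)^3 := by ring
  rcases le_or_gt 0 ((a+b+c)*(a*b*c)) with hw | hw
  · have e2le := cubes_le hab hbc hca hM
    rw [← hcub] at e2le
    have e13 : 0 ≤ (a^3+b^3+c^3) * (a*b*c)^3 := by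
      have : (a^3+b^3+c^3) * (a*b*c)^3 = (a*b*c)^2 * (((a+b+c)*(a*b*c)) *
        (((a-b)^2+(b-c)^2+(c-a)^2)/2) + 3*(a*b*c)^2) := by ring
      rw [this]; positivity
    exact (fin1 e2n e2le e13).trans_le hJ
  · have e2le := e2_le hab hbc hca (by linarith)
      (by linarith [sq_nonneg (a*b*c)])
    rw [← hcub] at e2le
    have hw6 : -(1/6) ≤ (a+b+c)*(a*b*c) := by
      linarith [sq_nonneg (a*b+b*c+c*a)]
    have hr2 : (a*b*c)^2 ≤ 1/36 := by
      have : (a*b*c)^2 ≤ ((a+b+c)*(a*b*c))^2 := by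
        rw [mul_pow]; nlinarith [sq_nonneg (a*b*c)]
      have h36 : ((a+b+c)*(a*b*c))^2 ≤ 1/36 := by
        generalize (a+b+c)*(a*b*c) = w at *
        nlinarith
      linarith
    have hr3 : ((a*b*c)^3)^2 ≤ (1/216)^2 := by
      have : ((a*b*c)^2)^3 ≤ (1/36)^3 := pow_le_pow_left₀ (sq_nonneg _) hr2 3
      calc ((a*b*c)^3)^2 = ((a*b*c)^2)^3 := by ring
        _ ≤ _ := this
        _ = _ := by norm_num
    have e13 : -(1/216) ≤ (a^3+b^3+c^3) * (a*b*c)^3 := by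
      refine (abs_le_of_sq_le_sq' ?_ (by norm_num)).1
      rw [mul_pow]
      calc _ ≤ 1 * (1/216)^2 := mul_le_mul hE hr3 (sq_nonneg _) (by norm_num)
        _ = _ := by norm_num
    exact (fin2 e2n e2le e13).trans_le hJ

lemma lower (a b c : ℝ) (h : a ^ 2 + b ^ 2 + c ^ 2 = 1) (hJ : 729 * I₁₂ a b c ≤ -(3/32)) :
    a + b + c = 0 ∧ a*b*c = 0 := by
  rcases le_total ((a+b+c)^2) 1 with hP | hP
  · have e := I12_pr a b c h _ _ _ rfl rfl rfl
    refine small_P _ _ _ _ rfl rfl hP (r_sq a b c h) ?_ (by rw [← e]; linarith)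
    nlinarith [sq_nonneg (a*b+b*c+c*a), sum_sq_prod a b c h]
  · linarith [large_P a b c h hP]

lemma value {a b c s : ℝ} (hs : s^2 = 1/2)
    (hm : ({a, b, c} : Multiset ℝ) = {s, -s, 0}) : 729 * I₁₂ a b c = -(3/32) := by
  have e (k : ℕ) : a^k+b^k+c^k = s^k+(-s)^k+0^k := by
    have := congrArg (fun m => (m.map (fun x => x^k)).sum) hm
    simpa [add_assoc] using this
  have h3 := e 3
  have h6 := e 6
  have hp : (a*b*c) = 0 := by
    have := congrArg Multiset.prod hm
    simpa [mul_assoc] using this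
  have s6 : s^6 = 1/8 := by rw [show s^6=(s^2)^3 by ring, hs]; norm_num
  have h3' : a^3+b^3+c^3 = 0 := by rw [h3]; ring
  have h2' : a^3*b^3+b^3*c^3+c^3*a^3 = -1/8 := by
    have : s^6+(-s)^6+0^6 = 1/4 := by rw [show (-s)^6 = s^6 by ring, s6]; norm_num
    have h9 : (a^3+b^3+c^3)^2 = 0 := by rw [h3']; norm_num
    nlinarith
  rw [I12_e, h3', h2', hp]; norm_num

lemma roots {x y s : ℝ} (hs : s^2 = 1/2) (h : x + y = 0) (h2 : x^2+y^2 = 1) :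
    (x = s ∧ y = -s) ∨ (x = -s ∧ y = s) := by
  have hy : y = -x := by linarith
  have : x^2 = s^2 := by rw [hs]; rw [hy] at h2; linarith [neg_sq x]
  rcases sq_eq_sq_iff_eq_or_eq_neg.1 this with h | h
  · left; exact ⟨h, by linarith⟩
  · right; exact ⟨h, by linarith⟩

/-- `|I₁₂| = 1/7776` on the unit sphere exactly at permutations of `(1/√2, -1/√2, 0)`. -/
theorem abs_I₁₂_eq_max_iff (a b c : ℝ) (h : a ^ 2 + b ^ 2 + c ^ 2 = 1) :
    |I₁₂ a b c| = 1 / 7776 ↔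
      ({a, b, c} : Multiset ℝ) = {1 / Real.sqrt 2, -(1 / Real.sqrt 2), 0} := by
  have hs : (1 / Real.sqrt 2)^2 = 1/2 := by
    rw [div_pow, Real.sq_sqrt (by norm_num)]; norm_num
  generalize 1 / Real.sqrt 2 = s at *
  constructor
  · intro hI
    have hJ : 729 * I₁₂ a b c ≤ -(3/32) := by
      have := upper a b c h
      rcases (abs_eq (by norm_num)).1 hI with h1 | h1 <;> linarith
    obtain ⟨hp, hr⟩ := lower a b c h hJ
    have key : ∀ x y : ℝ, x + y = 0 → x^2+y^2 = 1 →
        ({x, y, 0} : Multiset ℝ) = {s, -s, 0} := by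
      intro x y h1 h2
      rcases roots hs h1 h2 with ⟨rfl, rfl⟩ | ⟨rfl, rfl⟩
      · rfl
      · exact Multiset.cons_swap _ _ _
    rcases mul_eq_zero.1 hr with hr | hr
    · rcases mul_eq_zero.1 hr with hr | hr
      · subst hr
        rw [← key b c (by linarith) (by linarith)]
        change (0 ::ₘ b ::ₘ c ::ₘ 0 : Multiset ℝ) = b ::ₘ c ::ₘ 0 ::ₘ 0
        rw [Multiset.cons_swap 0 b, Multiset.cons_swap 0 c]
      · subst hr
        rw [← key a c (by linarith) (by linarith)]
        change (a ::ₘ 0 ::ₘ c ::ₘ 0 : Multiset ℝ) = a ::ₘ c ::ₘ 0 ::ₘ 0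
        rw [Multiset.cons_swap 0 c]
    · subst hr
      exact key a b (by linarith) (by linarith)
  · intro hm
    have := value hs hm
    have h2 : I₁₂ a b c = -(1/7776) := by linarith
    rw [h2, abs_neg, abs_of_pos (by norm_num)]
end

section
/- For all real numbers a, b, c with a² + b² + c² = 1, the weighted sum S(a,b,c) = |I₆(a,b,c)|/(1/18) + |I₉(a,b,c)|/(√6/3888) + |I₁₂(a,b,c)|/(1/7776) is at most 3, and S(a,b,c) = 3 holds if and only if (a,b,c) is a permutation of (1/√2, −1/√2, 0). (The Aharonov state is a simultaneous maximizer of all three fundamental invariants.) -/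
/-- Restriction of the degree-6 fundamental invariant to normalized semi-simple states. -/
noncomputable def I₆ (a b c : ℝ) : ℝ :=
  (1 / 27) * (a ^ 6 - 10 * a ^ 3 * b ^ 3 - 10 * a ^ 3 * c ^ 3 + b ^ 6 -
    10 * b ^ 3 * c ^ 3 + c ^ 6)

/-- The slack `3/2 - 27 I₆` in the variables `u = a+b+c`, `t = abc`. -/
lemma aux_slack (u t : ℝ) (hw : u * t ≤ (u ^ 2 - 1) ^ 2 / 12) :
    0 ≤ 27 * t ^ 2 + u * t * (9 - 15 * u ^ 2) +
        u ^ 2 * (9 / 4 - 3 * u ^ 2 + 5 / 4 * u ^ 4) ∧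
    (27 * t ^ 2 + u * t * (9 - 15 * u ^ 2) +
        u ^ 2 * (9 / 4 - 3 * u ^ 2 + 5 / 4 * u ^ 4) = 0 → u = 0 ∧ t = 0) := by
  by_cases hv : u ^ 2 ≤ 1
  · have key : 108 * (27 * t ^ 2 + u * t * (9 - 15 * u ^ 2) +
        u ^ 2 * (9 / 4 - 3 * u ^ 2 + 5 / 4 * u ^ 4)) =
        (54 * t + u * (9 - 15 * u ^ 2)) ^ 2 + u ^ 2 * (162 - 54 * u ^ 2 - 90 * u ^ 4) := by
      ring
    have hu := sq_nonneg u
    have h1 : 18 ≤ 162 - 54 * u ^ 2 - 90 * u ^ 4 := by nlinarith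
    have h2 : 18 * u ^ 2 ≤ u ^ 2 * (162 - 54 * u ^ 2 - 90 * u ^ 4) := by nlinarith
    have h3 := sq_nonneg (54 * t + u * (9 - 15 * u ^ 2))
    refine ⟨by linarith, fun h0 => ?_⟩
    have hu0 : u = 0 := by
      have : u ^ 2 = 0 := by linarith
      exact pow_eq_zero_iff (two_ne_zero) |>.1 this
    subst hu0
    refine ⟨rfl, ?_⟩
    have : t ^ 2 = 0 := by linarith
    exact pow_eq_zero_iff (two_ne_zero) |>.1 this
  · have hv' : 1 < u ^ 2 := not_le.1 hv
    have h1 : 0 ≤ ((u ^ 2 - 1) ^ 2 / 12 - u * t) * (15 * u ^ 2 - 9) :=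
      mul_nonneg (by linarith) (by linarith)
    have h2 : 0 < 27 * t ^ 2 + u * t * (9 - 15 * u ^ 2) +
        u ^ 2 * (9 / 4 - 3 * u ^ 2 + 5 / 4 * u ^ 4) := by
      nlinarith [sq_nonneg t, sq_nonneg (u ^ 2 - 1)]
    exact ⟨h2.le, fun h0 => absurd h0 h2.ne'⟩

/-- Case `rs < 0` of the bound on `I₁₂`. -/
lemma aux_rs (u t : ℝ) (hut : u * t ≤ 0) (hu3 : u ^ 2 ≤ 3) (ht : t ^ 2 ≤ 1 / 27) :
    144 * (-(t ^ 3 * (u * (3 - u ^ 2) / 2 + 3 * t))) ≤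
      27 * t ^ 2 + u * t * (9 - 15 * u ^ 2) +
        u ^ 2 * (9 / 4 - 3 * u ^ 2 + 5 / 4 * u ^ 4) := by
  have hu := sq_nonneg u
  have ht0 := sq_nonneg t
  have h7 : 0 ≤ t ^ 2 * (-(u * t)) * u ^ 2 :=
    mul_nonneg (mul_nonneg ht0 (by linarith)) hu
  by_cases hv : u ^ 2 ≤ 2 / 5
  · have h1 : 0 ≤ 27 * t ^ 2 * (4 * t + u) ^ 2 := by positivity
    have h2 : 0 ≤ u ^ 2 * (1 / 27 - t ^ 2) := mul_nonneg hu (by linarith)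
    have h3 := sq_nonneg (54 * t + u * (9 - 15 * u ^ 2))
    have h4 : 0 ≤ u ^ 2 * (54 - 54 * u ^ 2 - 90 * u ^ 4) :=
      mul_nonneg hu (by nlinarith)
    nlinarith
  · have h1 : 0 ≤ (1 / 27 - t ^ 2) * (-(u * t)) :=
      mul_nonneg (by linarith) (by linarith)
    have h1' : 0 ≤ t ^ 4 := by positivity
    by_cases hv2 : u ^ 2 ≤ 6 / 5
    · have h3 := sq_nonneg (54 * t + u * (17 - 15 * u ^ 2))
      have h4 : 0 ≤ u ^ 2 * (108 * (9 / 4 - 3 * u ^ 2 + 5 / 4 * u ^ 4) - (17 - 15 * u ^ 2) ^ 2) :=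
        mul_nonneg hu (by nlinarith)
      nlinarith
    · have h5 : 0 ≤ (-(u * t)) * (15 * u ^ 2 - 17) :=
        mul_nonneg (by linarith) (by linarith)
      have h6 : 0 ≤ u ^ 2 * (9 / 4 - 3 * u ^ 2 + 5 / 4 * u ^ 4) :=
        mul_nonneg hu (by nlinarith [sq_nonneg (u ^ 2 - 6 / 5)])
      nlinarith

/-- Univariate-type estimate behind the bound on `I₉`. -/
lemma aux_nine_step (k R X V : ℝ) (hk : 0 < k) (hR : 0 ≤ R) (hX : 0 ≤ X) (hXR : X ≤ 4 * R)
    (hV : 0 ≤ V) (hA : 4 * R ≤ k * (R + V * (1 + k / 2))) :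
    (R + V * (1 + k / 2) + X / (2 * k)) ^ 2 * (4 * R - X) ≤
      (R + V * (1 + k / 2)) ^ 2 * (4 * R) := by
  obtain ⟨A, hAd⟩ : ∃ A, A = R + V * (1 + k / 2) := ⟨_, rfl⟩
  rw [← hAd] at hA ⊢
  obtain ⟨Y, hY⟩ : ∃ Y, Y = X / (2 * k) := ⟨_, rfl⟩
  have hXY : X = 2 * k * Y := by rw [hY]; field_simp
  rw [← hY, hXY]
  have hY0 : 0 ≤ Y := by rw [hY]; positivity
  have hA0 : 0 ≤ A := by rw [hAd]; positivity
  have e : A ^ 2 * (4 * R) - (A + Y) ^ 2 * (4 * R - 2 * k * Y) =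
      Y * (2 * A * (k * A - 4 * R) + Y * (k * A - 4 * R) + 3 * k * A * Y + 2 * k * Y ^ 2) := by
    ring
  have : 0 ≤ Y * (2 * A * (k * A - 4 * R) + Y * (k * A - 4 * R) + 3 * k * A * Y + 2 * k * Y ^ 2) := by
    have : 0 ≤ k * A - 4 * R := by linarith
    positivity
  linarith

lemma aux_uni1 (z : ℝ) (h0 : 0 ≤ z) (h1 : z ≤ 2 / 5) :
    ((1 - z) ^ 3 + 24 * z ^ 3) ^ 2 * (1 - z) ^ 3 ≤ 1 := by
  have hz : 0 ≤ 1 - z := by linarith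
  have hB : 0 ≤ (1 - z) ^ 3 + 24 * z ^ 3 := by positivity
  by_cases hc : z ≤ 3 / 10
  · have hB1 : (1 - z) ^ 3 + 24 * z ^ 3 ≤ 1 := by
      have : 0 ≤ z * (3 - 3 * z - 23 * z ^ 2) := mul_nonneg h0 (by nlinarith)
      linarith
    have h2 : ((1 - z) ^ 3 + 24 * z ^ 3) ^ 2 ≤ 1 := pow_le_one₀ hB hB1
    have h3 : (1 - z) ^ 3 ≤ 1 := pow_le_one₀ hz (by linarith)
    exact mul_le_one₀ h2 (by positivity) h3
  · push Not at hc
    have hB1 : (1 - z) ^ 3 + 24 * z ^ 3 ≤ 1 + 19 / 10 * z := by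
      have : 0 ≤ z * (49 / 10 - 3 * z - 23 * z ^ 2) := mul_nonneg h0 (by nlinarith)
      linarith
    have h2 : ((1 - z) ^ 3 + 24 * z ^ 3) * (1 - z) ≤ 11 / 10 := by
      have := mul_le_mul_of_nonneg_right hB1 hz
      nlinarith
    have h3 := pow_le_pow_left₀ (mul_nonneg hB hz) h2 2
    have h4 := mul_le_mul h3 (by linarith : 1 - z ≤ 7 / 10) hz (by norm_num)
    linarith

lemma aux_uni2 (y : ℝ) (h0 : 0 ≤ y) (h1 : y ≤ 3 / 5) :
    (y ^ 3 + 12 * (1 - y) ^ 3) ^ 2 * y ^ 3 ≤ 1 := by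
  have h2 : (1 - y) ^ 2 * y ≤ 4 / 27 := by
    have : 0 ≤ (y - 1 / 3) ^ 2 * (4 / 3 - y) := mul_nonneg (sq_nonneg _) (by linarith)
    linarith
  have h3 : ((1 - y) ^ 2 * y) ^ 3 ≤ (4 / 27) ^ 3 := pow_le_pow_left₀ (by positivity) h2 3
  have h4 : y ^ 9 ≤ (3 / 5) ^ 9 := pow_le_pow_left₀ h0 h1 9
  have h5 : 0 ≤ (y ^ 3 - 12 * (1 - y) ^ 3) ^ 2 * y ^ 3 := by positivity
  linarith

lemma aux_nine (u g Q : ℝ) (hQ : Q = (3 - u ^ 2) / 2) (hQ0 : 0 ≤ Q)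
    (hg : g ^ 2 ≤ 4 * Q ^ 3) (hP : 0 ≤ Q ^ 3 + u ^ 6 - u ^ 3 * g) :
    (Q ^ 3 + u ^ 6 - u ^ 3 * g) ^ 2 * (4 * Q ^ 3 - g ^ 2) ≤ 27 ^ 3 / 128 := by
  have hR : 0 ≤ Q ^ 3 := by positivity
  have hV : 0 ≤ u ^ 6 := by positivity
  have hv : 0 ≤ u ^ 2 := sq_nonneg u
  have hD : 0 ≤ 4 * Q ^ 3 - g ^ 2 := by linarith
  have h6 : u ^ 6 = (u ^ 2) ^ 3 := by ring
  by_cases hc : u ^ 2 ≤ 6 / 5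
  · have h1 : Q ^ 3 + u ^ 6 - u ^ 3 * g ≤ Q ^ 3 + u ^ 6 * (1 + 4 / 2) + g ^ 2 / (2 * 4) := by
      nlinarith [sq_nonneg (4 * u ^ 3 + g)]
    have h2 := aux_nine_step 4 (Q ^ 3) (g ^ 2) (u ^ 6) (by norm_num) hR (sq_nonneg g) hg hV
      (by nlinarith)
    have h3 := mul_le_mul_of_nonneg_right (pow_le_pow_left₀ hP h1 2) hD
    refine h3.trans (h2.trans ?_)
    have h4 := aux_uni1 (u ^ 2 / 3) (by linarith) (by linarith)
    rw [h6, hQ]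
    linarith
  · have hc' : 6 / 5 < u ^ 2 := not_le.1 hc
    have h1 : Q ^ 3 + u ^ 6 - u ^ 3 * g ≤ Q ^ 3 + u ^ 6 * (1 + 1 / 2) + g ^ 2 / (2 * 1) := by
      nlinarith [sq_nonneg (u ^ 3 + g)]
    have h2 := aux_nine_step 1 (Q ^ 3) (g ^ 2) (u ^ 6) (by norm_num) hR (sq_nonneg g) hg hV
      (by
        have : Q ^ 3 ≤ (9 / 10) ^ 3 := pow_le_pow_left₀ hQ0 (by linarith) 3
        have : (6 / 5) ^ 3 ≤ (u ^ 2) ^ 3 := pow_le_pow_left₀ (by norm_num) hc'.le 3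
        rw [h6]
        linarith)
    have h3 := mul_le_mul_of_nonneg_right (pow_le_pow_left₀ hP h1 2) hD
    refine h3.trans (h2.trans ?_)
    have h4 := aux_uni2 (1 - u ^ 2 / 3) (by linarith) (by linarith)
    rw [h6, hQ]
    linarith

set_option maxHeartbeats 2000000 in
/-- All polynomial facts needed. `F = 27 I₆`, `G = product in I₉`, `E = 729 I₁₂`. -/
lemma aux_main (a b c : ℝ) (h : a ^ 2 + b ^ 2 + c ^ 2 = 1) (F G E : ℝ)
    (hF : F = a ^ 6 - 10 * a ^ 3 * b ^ 3 - 10 * a ^ 3 * c ^ 3 + b ^ 6 -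
      10 * b ^ 3 * c ^ 3 + c ^ 6)
    (hG : G = (a - b) * (a - c) * (b - c) *
      (a ^ 2 + a * b + b ^ 2) * (a ^ 2 + a * c + c ^ 2) * (b ^ 2 + b * c + c ^ 2))
    (hE : E = a ^ 9 * b ^ 3 + a ^ 3 * b ^ 9 + a ^ 9 * c ^ 3 + b ^ 9 * c ^ 3 +
      a ^ 3 * c ^ 9 + b ^ 3 * c ^ 9 -
      4 * (a ^ 6 * b ^ 6 + a ^ 6 * c ^ 6 + b ^ 6 * c ^ 6) +
      2 * (a ^ 6 * b ^ 3 * c ^ 3 + a ^ 3 * b ^ 6 * c ^ 3 + a ^ 3 * b ^ 3 * c ^ 6)) :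
    |F| ≤ 3 / 2 ∧ G ^ 2 ≤ 1 / 128 ∧ |E| ≤ 3 / 32 ∧
    (|F| = 3 / 2 → a + b + c = 0 ∧ a * b * c = 0) ∧
    (a + b + c = 0 → a * b * c = 0 → F = 3 / 2 ∧ G ^ 2 = 1 / 128 ∧ E = - (3 / 32)) := by
  obtain ⟨u, hu⟩ : ∃ u, u = a + b + c := ⟨_, rfl⟩
  obtain ⟨t, ht⟩ : ∃ t, t = a * b * c := ⟨_, rfl⟩
  obtain ⟨τ, hτ⟩ : ∃ τ, τ = a * b + b * c + c * a := ⟨_, rfl⟩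
  obtain ⟨s, hs⟩ : ∃ s, s = a ^ 3 + b ^ 3 + c ^ 3 := ⟨_, rfl⟩
  obtain ⟨e, he⟩ : ∃ e, e = a ^ 2 * b ^ 2 + b ^ 2 * c ^ 2 + c ^ 2 * a ^ 2 := ⟨_, rfl⟩
  obtain ⟨p6, hp6⟩ : ∃ p, p = a ^ 6 + b ^ 6 + c ^ 6 := ⟨_, rfl⟩
  have hEF : - E = (F ^ 2 - s ^ 4) / 24 - 9 * (t ^ 3 * s) := by
    rw [hE, hF, hs, ht]; ring
  have hFs : F = 6 * p6 - 5 * s ^ 2 := by rw [hF, hp6, hs]; ring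
  have hF1 : F = (u ^ 3 - 3 * u * τ + 3 * t) ^ 2 - 12 * (τ ^ 3 - 3 * τ * u * t + 3 * t ^ 2) := by
    rw [hF, hu, hτ, ht]; ring
  have hGG : G ^ 2 = ((a - b) * (a - c) * (b - c)) ^ 2 *
      ((a ^ 2 + a * b + b ^ 2) * (a ^ 2 + a * c + c ^ 2) * (b ^ 2 + b * c + c ^ 2)) ^ 2 := by
    rw [hG]; ring
  clear hF hG hE
  have hτu : τ = (u ^ 2 - 1) / 2 := by rw [hτ, hu]; linear_combination (-1 / 2) * h
  have hs' : s = u * (3 - u ^ 2) / 2 + 3 * t := by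
    have : s = u ^ 3 - 3 * u * τ + 3 * t := by rw [hs, hu, hτ, ht]; ring
    rw [this, hτu]; ring
  have hp4 : a ^ 4 + b ^ 4 + c ^ 4 = 1 - 2 * e := by
    have : a ^ 4 + b ^ 4 + c ^ 4 = (a ^ 2 + b ^ 2 + c ^ 2) ^ 2 - 2 * e := by rw [he]; ring
    rw [this, h]; ring
  have hu3 : u ^ 2 ≤ 3 := by
    rw [hu]; linarith [sq_nonneg (a - b), sq_nonneg (b - c), sq_nonneg (c - a)]
  -- the slack
  have hFδ : 3 / 2 - F = 27 * t ^ 2 + u * t * (9 - 15 * u ^ 2) +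
        u ^ 2 * (9 / 4 - 3 * u ^ 2 + 5 / 4 * u ^ 4) := by
    rw [hF1, hτu]; ring
  have hw : u * t ≤ (u ^ 2 - 1) ^ 2 / 12 := by
    have h1 : 3 * (u * t) ≤ τ ^ 2 := by
      rw [hu, ht, hτ]
      linarith [sq_nonneg (a * b - b * c), sq_nonneg (b * c - c * a), sq_nonneg (c * a - a * b)]
    rw [hτu] at h1; linarith
  obtain ⟨hsl, hsl0⟩ := aux_slack u t hw
  rw [← hFδ] at hsl hsl0
  have hs4 : s ^ 2 ≤ 1 - 2 * e := by
    have h1 : s ^ 2 ≤ (a ^ 2 + b ^ 2 + c ^ 2) * (a ^ 4 + b ^ 4 + c ^ 4) := by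
      rw [hs]
      linarith [sq_nonneg (a * b ^ 2 - b * a ^ 2), sq_nonneg (b * c ^ 2 - c * b ^ 2),
        sq_nonneg (c * a ^ 2 - a * c ^ 2)]
    rw [h, hp4] at h1; linarith
  have hp64 : (1 - 2 * e) ^ 2 ≤ p6 := by
    have h1 : (a ^ 4 + b ^ 4 + c ^ 4) ^ 2 ≤ (a ^ 2 + b ^ 2 + c ^ 2) * p6 := by
      rw [hp6]
      linarith [sq_nonneg (a * b ^ 3 - b * a ^ 3), sq_nonneg (b * c ^ 3 - c * b ^ 3),
        sq_nonneg (c * a ^ 3 - a * c ^ 3)]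
    rw [h, hp4] at h1; linarith
  have hFlow : - (25 / 24) ≤ F := by
    linarith [sq_nonneg ((1 - 2 * e) - 5 / 12)]
  have he0 : 0 ≤ e := by rw [he]; positivity
  have he3 : e ≤ 1 / 3 := by
    have h1 : 3 * e ≤ (a ^ 2 + b ^ 2 + c ^ 2) ^ 2 := by
      rw [he]
      linarith [sq_nonneg (a ^ 2 - b ^ 2), sq_nonneg (b ^ 2 - c ^ 2), sq_nonneg (c ^ 2 - a ^ 2)]
    rw [h] at h1; linarith
  have hte : 3 * t ^ 2 ≤ e ^ 2 := by
    have h1 : 3 * t ^ 2 * (a ^ 2 + b ^ 2 + c ^ 2) ≤ e ^ 2 := by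
      rw [he, ht]
      linarith [sq_nonneg (a ^ 2 * b ^ 2 - b ^ 2 * c ^ 2), sq_nonneg (b ^ 2 * c ^ 2 - c ^ 2 * a ^ 2),
        sq_nonneg (c ^ 2 * a ^ 2 - a ^ 2 * b ^ 2)]
    rw [h] at h1; linarith
  have ht27 : t ^ 2 ≤ 1 / 27 := by
    have := pow_le_pow_left₀ he0 he3 2
    linarith
  -- bound on rs
  have hrs : |t ^ 3 * s| ≤ 1 / 243 := by
    apply abs_le_of_sq_le_sq _ (by norm_num)
    have h1 : (t ^ 2) ^ 3 ≤ (e ^ 2 / 3) ^ 3 := pow_le_pow_left₀ (sq_nonneg t) (by linarith) 3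
    have h2 : (t ^ 3 * s) ^ 2 ≤ (e ^ 2 / 3) ^ 3 * (1 - 2 * e) := by
      have : (t ^ 3 * s) ^ 2 = (t ^ 2) ^ 3 * s ^ 2 := by ring
      rw [this]
      exact mul_le_mul h1 hs4 (sq_nonneg s) (by positivity)
    have h3 : e ^ 4 ≤ (1 / 3) ^ 4 := pow_le_pow_left₀ he0 he3 4
    have h4 : e ^ 2 * (1 - 2 * e) ≤ 1 / 27 := by
      have : 0 ≤ (e - 1 / 3) ^ 2 * (2 * e + 1 / 3) := by positivity
      linarith
    have h5 : e ^ 4 * (e ^ 2 * (1 - 2 * e)) ≤ (1 / 3) ^ 4 * (1 / 27) :=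
      mul_le_mul h3 h4 (mul_nonneg (sq_nonneg e) (by linarith)) (by positivity)
    linarith
  have hrs' := abs_le.1 hrs
  have hs1 : s ^ 4 ≤ 1 := by
    have : s ^ 4 = (s ^ 2) ^ 2 := by ring
    rw [this]; exact pow_le_one₀ (sq_nonneg s) (by linarith)
  have hs0 : 0 ≤ s ^ 4 := by positivity
  have hP : (a ^ 2 + a * b + b ^ 2) * (a ^ 2 + a * c + c ^ 2) * (b ^ 2 + b * c + c ^ 2) =
      (((3 - u ^ 2) / 2) ^ 3 + u ^ 6 - u ^ 3 * (27 * t + (9 * u - 5 * u ^ 3) / 2)) / 27 := by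
    have h1 : (a ^ 2 + a * b + b ^ 2) * (a ^ 2 + a * c + c ^ 2) * (b ^ 2 + b * c + c ^ 2) =
      (u ^ 2 - τ) ^ 3 - (u ^ 2 - τ) ^ 2 * u ^ 2 + (u ^ 2 - τ) * u ^ 2 * τ - u ^ 3 * t := by
      rw [hu, hτ, ht]; ring
    rw [h1, hτu]; ring
  have hD : ((a - b) * (a - c) * (b - c)) ^ 2 =
      (4 * ((3 - u ^ 2) / 2) ^ 3 - (27 * t + (9 * u - 5 * u ^ 3) / 2) ^ 2) / 27 := by
    have h1 : ((a - b) * (a - c) * (b - c)) ^ 2 =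
      u ^ 2 * τ ^ 2 - 4 * τ ^ 3 - 4 * u ^ 3 * t + 18 * u * τ * t - 27 * t ^ 2 := by
      rw [hu, hτ, ht]; ring
    rw [h1, hτu]; ring
  refine ⟨abs_le.2 ⟨by linarith, by linarith⟩, ?_, ?_, ?_, ?_⟩
  · have hD0 := sq_nonneg ((a - b) * (a - c) * (b - c))
    have hq : ∀ x y : ℝ, 0 ≤ x ^ 2 + x * y + y ^ 2 := fun x y => by
      have : x ^ 2 + x * y + y ^ 2 = (x + y / 2) ^ 2 + 3 / 4 * y ^ 2 := by ring
      rw [this]; positivity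
    have hP0 := mul_nonneg (mul_nonneg (hq a b) (hq a c)) (hq b c)
    rw [hD] at hD0
    rw [hP] at hP0
    have := aux_nine u (27 * t + (9 * u - 5 * u ^ 3) / 2) ((3 - u ^ 2) / 2) rfl (by linarith)
      (by linarith) (by linarith)
    rw [hGG, hD, hP]
    linarith
  · have hF2 : F ^ 2 ≤ 9 / 4 := by
      have := mul_nonneg hsl (by linarith : 0 ≤ 3 / 2 + F)
      linarith
    rw [← abs_neg, hEF]
    refine abs_le.2 ⟨by linarith [sq_nonneg F], ?_⟩
    rcases le_or_gt 0 (t ^ 3 * s) with h0 | h0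
    · linarith
    · rcases le_or_gt 0 F with hF0 | hF0
      · have hut : u * t ≤ 0 := by
          by_contra hcon
          push Not at hcon
          have : 0 ≤ t ^ 3 * s := by
            have e1 : t ^ 3 * s = t ^ 2 * ((u * t) * (3 - u ^ 2) / 2 + 3 * t ^ 2) := by
              rw [hs']; ring
            have : 0 ≤ 3 - u ^ 2 := by linarith
            rw [e1]; positivity
          linarith
        have h1 := aux_rs u t hut hu3 ht27
        rw [← hs', ← hFδ] at h1
        linarith [mul_nonneg hF0 hsl]
      · have := mul_nonneg (by linarith : 0 ≤ -F) (by linarith : 0 ≤ F + 25 / 24)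
        linarith
  · intro hF3
    rw [← hu, ← ht]
    apply hsl0
    rcases abs_eq (by norm_num : (0 : ℝ) ≤ 3 / 2) |>.1 hF3 with h0 | h0 <;> linarith
  · intro h1 h2
    rw [← hu] at h1
    rw [← ht] at h2
    have hF3 : F = 3 / 2 := by rw [h1, h2] at hFδ; linarith
    have hs00 : s = 0 := by rw [hs', h1, h2]; ring
    refine ⟨hF3, ?_, ?_⟩
    · rw [hGG, hD, hP, h1, h2]; norm_num
    · rw [hF3, hs00] at hEF; linarith

lemma aux_multiset (a b c : ℝ) (h : a ^ 2 + b ^ 2 + c ^ 2 = 1) :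
    ({a, b, c} : Multiset ℝ) = {1 / Real.sqrt 2, -(1 / Real.sqrt 2), 0} ↔
      a + b + c = 0 ∧ a * b * c = 0 := by
  have hr : (1 / Real.sqrt 2) ^ 2 = 1 / 2 := by
    rw [div_pow, Real.sq_sqrt (by norm_num)]; norm_num
  generalize 1 / Real.sqrt 2 = r at *
  constructor
  · intro hm
    have h1 := congrArg Multiset.sum hm
    have h2 := congrArg Multiset.prod hm
    simp at h1 h2
    refine ⟨by linarith, ?_⟩
    rcases h2 with h2 | h2 | h2 <;> simp [h2]
  · rintro ⟨h1, h2⟩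
    have key : ∀ x y : ℝ, x + y = 0 → x ^ 2 + y ^ 2 = 1 →
        (x = r ∧ y = -r) ∨ (x = -r ∧ y = r) := by
      intro x y hxy hx
      have hy : y = -x := by linarith
      subst hy
      have : x ^ 2 = r ^ 2 := by rw [hr]; linarith [neg_sq x]
      rcases sq_eq_sq_iff_eq_or_eq_neg.1 this with h3 | h3
      · left; exact ⟨h3, by rw [h3]⟩
      · right; exact ⟨h3, by rw [h3]; ring⟩
    have sw : ∀ x y z : ℝ, ({x, y, z} : Multiset ℝ) = {y, x, z} := fun x y z =>
      Multiset.cons_swap x y {z}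
    have sw2 : ∀ x y z : ℝ, ({x, y, z} : Multiset ℝ) = {x, z, y} := fun x y z =>
      congrArg (Multiset.cons x) (Multiset.pair_comm y z)
    rcases mul_eq_zero.1 h2 with h3 | h3
    · rcases mul_eq_zero.1 h3 with h4 | h4
      · subst h4
        rcases key b c (by linarith) (by linarith) with ⟨rfl, rfl⟩ | ⟨rfl, rfl⟩
        · rw [sw, sw2]
        · rw [sw2, sw, sw2]
      · subst h4
        rcases key a c (by linarith) (by linarith) with ⟨rfl, rfl⟩ | ⟨rfl, rfl⟩
        · rw [sw2]
        · rw [sw2, sw]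
    · subst h3
      rcases key a b (by linarith) (by linarith) with ⟨rfl, rfl⟩ | ⟨rfl, rfl⟩
      · rfl
      · rw [sw]

/-- The weighted sum of the normalized absolute values of the three fundamental
invariants is at most 3 on the unit sphere, with equality exactly at permutations of
`(1/√2, -1/√2, 0)` (the Aharonov state is a simultaneous maximizer). -/
theorem weighted_sum_le_three (a b c : ℝ) (h : a ^ 2 + b ^ 2 + c ^ 2 = 1) :
    |I₆ a b c| / (1 / 18) + |I₉ a b c| / (Real.sqrt 6 / 3888) +
        |I₁₂ a b c| / (1 / 7776) ≤ 3 ∧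
      (|I₆ a b c| / (1 / 18) + |I₉ a b c| / (Real.sqrt 6 / 3888) +
          |I₁₂ a b c| / (1 / 7776) = 3 ↔
        ({a, b, c} : Multiset ℝ) = {1 / Real.sqrt 2, -(1 / Real.sqrt 2), 0}) := by
  obtain ⟨F, hF⟩ : ∃ F, F = a ^ 6 - 10 * a ^ 3 * b ^ 3 - 10 * a ^ 3 * c ^ 3 + b ^ 6 -
    10 * b ^ 3 * c ^ 3 + c ^ 6 := ⟨_, rfl⟩
  obtain ⟨G, hG⟩ : ∃ G, G = (a - b) * (a - c) * (b - c) *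
      (a ^ 2 + a * b + b ^ 2) * (a ^ 2 + a * c + c ^ 2) * (b ^ 2 + b * c + c ^ 2) := ⟨_, rfl⟩
  obtain ⟨E, hE⟩ : ∃ E, E = a ^ 9 * b ^ 3 + a ^ 3 * b ^ 9 + a ^ 9 * c ^ 3 + b ^ 9 * c ^ 3 +
      a ^ 3 * c ^ 9 + b ^ 3 * c ^ 9 -
      4 * (a ^ 6 * b ^ 6 + a ^ 6 * c ^ 6 + b ^ 6 * c ^ 6) +
      2 * (a ^ 6 * b ^ 3 * c ^ 3 + a ^ 3 * b ^ 6 * c ^ 3 + a ^ 3 * b ^ 3 * c ^ 6) := ⟨_, rfl⟩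
  obtain ⟨m1, m2, m3, m4, m5⟩ := aux_main a b c h F G E hF hG hE
  have e6 : |I₆ a b c| / (1 / 18) = 2 / 3 * |F| := by
    have : I₆ a b c = 1 / 27 * F := by rw [I₆, hF]
    rw [this, abs_mul, abs_of_pos (by norm_num : (0 : ℝ) < 1 / 27)]; ring
  have e12 : |I₁₂ a b c| / (1 / 7776) = 32 / 3 * |E| := by
    have : I₁₂ a b c = 1 / 729 * E := by rw [I₁₂, hE]
    rw [this, abs_mul, abs_of_pos (by norm_num : (0 : ℝ) < 1 / 729)]; ring
  have e9 : |I₉ a b c| / (Real.sqrt 6 / 3888) = 8 * Real.sqrt 2 * |G| := by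
    have h1 : I₉ a b c = -(Real.sqrt 3 / 243 * G) := by rw [I₉, hG]; ring
    have h3 : 0 < Real.sqrt 3 := by positivity
    have h2 : 0 < Real.sqrt 2 := by positivity
    have h6 : Real.sqrt 6 = Real.sqrt 2 * Real.sqrt 3 := by
      rw [← Real.sqrt_mul (by norm_num)]; norm_num
    have h22 : Real.sqrt 2 ^ 2 = 2 := Real.sq_sqrt (by norm_num)
    rw [h1, abs_neg, abs_mul, abs_of_pos (by positivity : 0 < Real.sqrt 3 / 243), h6]
    field_simp
    linear_combination (-1944) * |G| * h22
  have e9sq : (8 * Real.sqrt 2 * |G|) ^ 2 = 128 * G ^ 2 := by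
    rw [mul_pow, mul_pow, Real.sq_sqrt (by norm_num), sq_abs]; ring
  have e9nn : 0 ≤ 8 * Real.sqrt 2 * |G| := by positivity
  have e9le : 8 * Real.sqrt 2 * |G| ≤ 1 :=
    (sq_le_one_iff₀ e9nn).1 (by rw [e9sq]; linarith)
  rw [e6, e9, e12, aux_multiset a b c h]
  refine ⟨by linarith, fun h3 => m4 (by linarith), fun ⟨h1, h2⟩ => ?_⟩
  obtain ⟨n1, n2, n3⟩ := m5 h1 h2
  have : 8 * Real.sqrt 2 * |G| = 1 := by
    exact (pow_eq_one_iff_of_nonneg e9nn two_ne_zero).1 (by rw [e9sq, n2]; norm_num)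
  rw [this, n1, n3, abs_neg, abs_of_pos (by norm_num : (0 : ℝ) < 3 / 2),
    abs_of_pos (by norm_num : (0 : ℝ) < 3 / 32)]
  norm_num
end
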